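/- arXiv:2301.04635 — 4 statements merged into one kernel-verified Lean document; each statement's English description precedes it below -/
import Mathlib

section
/- Let G be an abelian group. Then G is FS-regular if and only if for every element g ∈ G of finite order, the order of g belongs to O_FS. -/
/-- The subset sums multiset: the multiset of sums of all sub-multisets of `A`. -/
def FS {G : Type*} [AddCommGroup G] (A : Multiset G) : Multiset G :=
  A.powerset.map Multiset.sum

/-- `A ∼₀ A'`: `A'` is obtained from `A` by flipping the signs of a zero-sum sub-multiset. -/
def Sim0 {G : Type*} [AddCommGroup G] [DecidableEq G] (A A' : Multiset G) : Prop :=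
  ∃ B ≤ A, B.sum = 0 ∧ A' = (A - B) + B.map (fun x => -x)

/-- A group `G` is `FS`-regular if `FS A = FS A'` exactly when `A ∼₀ A'`. -/
def FSRegular (G : Type*) [AddCommGroup G] [DecidableEq G] : Prop :=
  ∀ A A' : Multiset G, FS A = FS A' ↔ Sim0 A A'

/-- `O_FS` : odd naturals `n ≥ 1` such that `(ℤ/nℤ)*` is covered by `{±2^j : j ≥ 0}`. -/
def OFS (n : ℕ) : Prop :=
  Odd n ∧ 1 ≤ n ∧ ∀ x : ℤ, IsCoprime x (n : ℤ) →
    ∃ j : ℕ, (n : ℤ) ∣ x - 2 ^ j ∨ (n : ℤ) ∣ x + 2 ^ j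

set_option linter.unusedSectionVars false

lemma FS_cons {G : Type*} [AddCommGroup G] (a : G) (A : Multiset G) :
    FS (a ::ₘ A) = FS A + (FS A).map (fun x => a + x) := by
  simp [FS, Multiset.powerset_cons, Multiset.map_map]

lemma FS_zero {G : Type*} [AddCommGroup G] : FS (0 : Multiset G) = {0} := by
  simp [FS]

lemma FS_card {G : Type*} [AddCommGroup G] (A : Multiset G) :
    Multiset.card (FS A) = 2 ^ Multiset.card A := by
  simp [FS]

lemma FS_flip {G : Type*} [AddCommGroup G] (C B : Multiset G) :
    FS (C + B.map (fun x => -x)) = (FS (C + B)).map (fun x => x - B.sum) := by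
  induction B using Multiset.induction_on with
  | empty => simp
  | cons b B ih =>
    rw [Multiset.map_cons, Multiset.add_cons, Multiset.add_cons, FS_cons, FS_cons, ih]
    simp only [Multiset.map_add, Multiset.map_map, Function.comp_def, Multiset.sum_cons]
    rw [add_comm]
    congr 1
    · apply Multiset.map_congr rfl
      intro x _
      abel
    · apply Multiset.map_congr rfl
      intro x _
      abel

lemma FS_map {G H : Type*} [AddCommGroup G] [AddCommGroup H] (f : G →+ H) (A : Multiset G) :
    FS (A.map f) = (FS A).map f := by
  induction A using Multiset.induction_on with
  | empty => simp [FS_zero]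
  | cons a A ih =>
    rw [Multiset.map_cons, FS_cons, FS_cons, ih]
    simp [Multiset.map_map]

lemma FS_eq_of_Sim0 {G : Type*} [AddCommGroup G] [DecidableEq G] {A A' : Multiset G}
    (h : Sim0 A A') : FS A = FS A' := by
  obtain ⟨B, hB, h0, rfl⟩ := h
  rw [FS_flip, h0, Multiset.sub_add_cancel hB]
  simp

lemma sum_shift {G : Type*} [AddCommGroup G] (S : Multiset G) (s : G) :
    (S.map (fun x => x - s)).sum = S.sum - Multiset.card S • s := by
  induction S using Multiset.induction_on with
  | empty => simp
  | cons a S ih =>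
    simp only [Multiset.map_cons, Multiset.sum_cons, ih, Multiset.card_cons, add_smul, one_smul]
    abel

lemma two_pow_smul_zero {G : Type*} [AddCommGroup G] (h2 : ∀ g : G, 2 • g = 0 → g = 0)
    (k : ℕ) (s : G) (h : 2 ^ k • s = 0) : s = 0 := by
  induction k with
  | zero => simpa using h
  | succ k ih =>
    apply ih
    apply h2
    rw [← mul_smul, mul_comm, ← pow_succ]
    exact h

/-- If the symmetrized multiplicities agree, then equality of `FS` gives `Sim0`. -/
lemma Sim0_of_sym {G : Type*} [AddCommGroup G] [DecidableEq G]
    (h2 : ∀ g : G, 2 • g = 0 → g = 0) {A A' : Multiset G} (hFS : FS A = FS A')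
    (hs : ∀ a, A.count a + A.count (-a) = A'.count a + A'.count (-a)) : Sim0 A A' := by
  have hle : A - A' ≤ A := Multiset.sub_le_self _ _
  have hA' : A' = (A - (A - A')) + (A - A').map (fun x => -x) := by
    ext a
    have hc : ((A - A').map (fun x => -x)).count a = (A - A').count (-a) := by
      have := Multiset.count_map_eq_count' (fun x : G => -x) (A - A') neg_injective (-a)
      simpa using this
    rw [Multiset.count_add, hc]
    simp only [Multiset.count_sub]
    have := hs a
    omega
  refine ⟨A - A', hle, ?_, hA'⟩
  have h1 : FS A' = (FS A).map (fun x => x - (A - A').sum) := by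
    conv_lhs => rw [hA']
    rw [FS_flip, Multiset.sub_add_cancel hle]
  have h3 := congrArg Multiset.sum (hFS.trans h1)
  rw [sum_shift, FS_card] at h3
  exact two_pow_smul_zero h2 (Multiset.card A) _ (sub_eq_self.1 h3.symm)

/-- A 2-torsion element contradicts regularity. -/
lemma regular_no_two {G : Type*} [AddCommGroup G] [DecidableEq G] (hG : FSRegular G)
    (g : G) (hg : 2 • g = 0) : g = 0 := by
  have hgg : g + g = 0 := by rw [← two_nsmul]; exact hg
  have hneg : -g = g := neg_eq_of_add_eq_zero_left hgg
  have h : FS ({g, g} : Multiset G) = FS ({g, 0} : Multiset G) := by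
    have e1 : ({g, g} : Multiset G) = g ::ₘ g ::ₘ 0 := rfl
    have e2 : ({g, 0} : Multiset G) = 0 ::ₘ g ::ₘ 0 := Multiset.cons_swap _ _ _
    rw [e1, e2]
    simp only [FS_cons, FS_zero]
    simp [hgg]
    ext a
    simp [Multiset.count_cons, Multiset.count_singleton]
    omega
  obtain ⟨B, hB, h0, h1⟩ := (hG _ _).1 h
  have hz : (0 : G) ∈ ({g, g} : Multiset G) - B + B.map (fun x => -x) := by
    rw [← h1]; simp
  rw [Multiset.mem_add] at hz
  rcases hz with hz | hz
  · have := Multiset.mem_of_le (Multiset.sub_le_self _ _) hz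
    simpa [eq_comm] using this
  · obtain ⟨b, hb, hb'⟩ := Multiset.mem_map.1 hz
    have := Multiset.mem_of_le hB hb
    have hbg : b = g := by simpa using this
    rw [hbg, neg_eq_zero] at hb'
    exact hb'

lemma FS_dyadic {G : Type*} [AddCommGroup G] (g : G) (k : ℕ) :
    FS ((Multiset.range k).map (fun i => 2 ^ i • g)) =
      (Multiset.range (2 ^ k)).map (fun j => j • g) := by
  induction k with
  | zero =>
    have h1 : Multiset.range 1 = {0} := rfl
    simp [FS_zero, h1]
  | succ k ih =>
    rw [Multiset.range_succ, Multiset.map_cons, FS_cons, ih, pow_succ, mul_two,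
      Multiset.range_add]
    simp [Multiset.map_map, add_smul]

lemma range_mul_map {G : Type*} [AddCommGroup G] (g : G) (n c : ℕ) (hn : n • g = 0) :
    (Multiset.range (n * c)).map (fun j => j • g) =
      c • (Multiset.range n).map (fun j => j • g) := by
  induction c with
  | zero => simp
  | succ c ih =>
    rw [mul_add, mul_one, Multiset.range_add, Multiset.map_add, ih, add_smul, one_smul]
    simp [Multiset.map_map, add_smul, mul_comm n c, mul_smul, hn]

/-- The full cycle does not depend on the generator. -/
lemma cycle_map {G : Type*} [AddCommGroup G] [DecidableEq G] (g : G) (n : ℕ)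
    (hn : addOrderOf g = n) (hpos : 0 < n) (x : ℤ) (hx : IsCoprime x (n : ℤ)) :
    (Multiset.range n).map (fun j => j • g) = (Multiset.range n).map (fun j => j • (x • g)) := by
  have hnz : (n : ℤ) ≠ 0 := by exact_mod_cast hpos.ne'
  have hng : n • g = 0 := by rw [← hn]; exact addOrderOf_nsmul_eq_zero g
  have key : ∀ a b : ℤ, a • g = b • g ↔ (n : ℤ) ∣ a - b := by
    intro a b
    rw [← hn, addOrderOf_dvd_iff_zsmul_eq_zero, sub_smul, sub_eq_zero]
  have nd1 : ((Multiset.range n).map (fun j => j • g)).Nodup := by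
    refine Multiset.Nodup.map_on ?_ (Multiset.nodup_range n)
    intro a ha b hb h
    rw [Multiset.mem_range] at ha hb
    have h' : (a : ℤ) • g = (b : ℤ) • g := by simpa using h
    rw [key] at h'
    have : (a : ℤ) ≡ b [ZMOD n] := (Int.modEq_iff_dvd.2 (by simpa using (dvd_neg.2 h')))
    have h4 := (Int.natCast_modEq_iff).1 this
    exact Nat.ModEq.eq_of_lt_of_lt h4 ha hb
  have nd2 : ((Multiset.range n).map (fun j => j • (x • g))).Nodup := by
    refine Multiset.Nodup.map_on ?_ (Multiset.nodup_range n)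
    intro a ha b hb h
    rw [Multiset.mem_range] at ha hb
    have h' : ((a : ℤ) * x) • g = ((b : ℤ) * x) • g := by simpa [mul_smul] using h
    rw [key, ← sub_mul] at h'
    have h' := hx.symm.dvd_of_dvd_mul_right h'
    have : (a : ℤ) ≡ b [ZMOD n] := (Int.modEq_iff_dvd.2 (by simpa using (dvd_neg.2 h')))
    have h4 := (Int.natCast_modEq_iff).1 this
    exact Nat.ModEq.eq_of_lt_of_lt h4 ha hb
  symm
  refine Multiset.eq_of_le_of_card_le ((Multiset.le_iff_subset nd2).2 ?_) (by simp)
  intro y hy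
  obtain ⟨j, -, rfl⟩ := Multiset.mem_map.1 hy
  refine Multiset.mem_map.2 ⟨((j * x) % n).toNat, ?_, ?_⟩
  · rw [Multiset.mem_range]
    have := Int.emod_lt_of_pos ((j : ℤ) * x) (by exact_mod_cast hpos : (0 : ℤ) < n)
    omega
  · have h0 := Int.emod_nonneg ((j : ℤ) * x) hnz
    have : (((((j : ℤ) * x) % n).toNat : ℕ) : ℤ) • g = ((j : ℤ) * x) • g := by
      rw [key, Int.toNat_of_nonneg h0]
      exact Int.modEq_iff_dvd.1 (Int.mod_modEq _ _).symm
    rw [natCast_zsmul, mul_smul, natCast_zsmul] at this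
    exact this

lemma regular_imp_OFS {G : Type*} [AddCommGroup G] [DecidableEq G] (hG : FSRegular G)
    (g : G) (hg : IsOfFinAddOrder g) : OFS (addOrderOf g) := by
  have hpos : 0 < addOrderOf g := hg.addOrderOf_pos
  have hodd : Odd (addOrderOf g) := by
    by_contra h
    rw [Nat.not_odd_iff_even] at h
    obtain ⟨m, hm⟩ := h
    have h1 : m • g = 0 := by
      apply regular_no_two hG
      rw [← mul_smul, two_mul, ← hm]
      exact addOrderOf_nsmul_eq_zero g
    have := Nat.le_of_dvd (by omega) (addOrderOf_dvd_of_nsmul_eq_zero h1)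
    omega
  refine ⟨hodd, hpos, fun x hx => ?_⟩
  set n := addOrderOf g with hn
  set k := n.totient with hk
  have hkpos : 0 < k := Nat.totient_pos.2 hpos
  have hmod : 2 ^ k ≡ 1 [MOD n] :=
    Nat.ModEq.pow_totient (Nat.coprime_two_left.2 hodd)
  obtain ⟨c, hc⟩ := (Nat.modEq_iff_dvd' (Nat.one_le_two_pow)).1 hmod.symm
  have hc' : 2 ^ k = n * c + 1 := by
    have : 1 ≤ 2 ^ k := Nat.one_le_two_pow
    omega
  have hng : n • g = 0 := addOrderOf_nsmul_eq_zero g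
  have hnx : n • (x • g) = 0 := by rw [smul_comm, hng, smul_zero]
  have hFS : FS ((Multiset.range k).map (fun i => 2 ^ i • g)) =
      FS ((Multiset.range k).map (fun i => 2 ^ i • (x • g))) := by
    rw [FS_dyadic, FS_dyadic, hc', Multiset.range_succ, Multiset.map_cons, Multiset.map_cons,
      range_mul_map g n c hng, range_mul_map _ n c hnx, cycle_map g n hn.symm hpos x hx]
    simp [mul_comm n c, mul_smul, hng, hnx]
  obtain ⟨B, hB, -, h1⟩ := (hG _ _).1 hFS
  have hmem : x • g ∈ (Multiset.range k).map (fun i => 2 ^ i • (x • g)) :=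
    Multiset.mem_map.2 ⟨0, by simpa using hkpos, by simp⟩
  rw [h1, Multiset.mem_add] at hmem
  rcases hmem with hm | hm
  · obtain ⟨j, -, hj⟩ := Multiset.mem_map.1 (Multiset.mem_of_le (Multiset.sub_le_self _ _) hm)
    refine ⟨j, Or.inl ?_⟩
    rw [hn, addOrderOf_dvd_iff_zsmul_eq_zero, sub_smul, ← hj, sub_eq_zero]
    exact_mod_cast (natCast_zsmul g (2 ^ j)).symm
  · obtain ⟨b, hb, hb'⟩ := Multiset.mem_map.1 hm
    obtain ⟨j, -, hj⟩ := Multiset.mem_map.1 (Multiset.mem_of_le hB hb)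
    refine ⟨j, Or.inr ?_⟩
    rw [hn, addOrderOf_dvd_iff_zsmul_eq_zero, add_smul, ← hb', ← hj, neg_add_eq_zero]
    exact_mod_cast (natCast_zsmul g (2 ^ j)).symm


open Filter Topology in
/-- Tail bound from summation by parts. -/
lemma tail_bound (c : ℕ → ℂ) (C : ℝ) (hC : ∀ M, ‖∑ k ∈ Finset.range M, c k‖ ≤ C)
    (w : ℕ → ℝ) (K : ℕ) (hw : ∀ k, K ≤ k → w (k + 1) ≤ w k) (h0 : ∀ k, K ≤ k → 0 ≤ w k)
    (S : ℂ) (hS : HasSum (fun k => c k * (w k : ℂ)) S) :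
    ‖S - ∑ k ∈ Finset.range K, c k * (w k : ℂ)‖ ≤ 2 * C * w K := by
  have hC0 : 0 ≤ C := (norm_nonneg _).trans (hC 0)
  have key : ∀ d : ℕ, ‖(∑ k ∈ Finset.range (K + d), c k * (w k : ℂ) -
      ∑ k ∈ Finset.range K, c k * (w k : ℂ)) -
      (∑ k ∈ Finset.range (K + d), c k) * (w (K + d) : ℂ)‖ ≤ 2 * C * w K - C * w (K + d) := by
    intro d
    induction d with
    | zero =>
      simp only [add_zero, sub_self, zero_sub, norm_neg, norm_mul, Complex.norm_real,
        Real.norm_eq_abs, abs_of_nonneg (h0 K le_rfl)]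
      nlinarith [mul_le_mul_of_nonneg_right (hC K) (h0 K le_rfl)]
    | succ d ih =>
      have hstep : (∑ k ∈ Finset.range (K + (d + 1)), c k * (w k : ℂ) -
          ∑ k ∈ Finset.range K, c k * (w k : ℂ)) -
          (∑ k ∈ Finset.range (K + (d + 1)), c k) * (w (K + (d + 1)) : ℂ) =
          ((∑ k ∈ Finset.range (K + d), c k * (w k : ℂ) -
          ∑ k ∈ Finset.range K, c k * (w k : ℂ)) -
          (∑ k ∈ Finset.range (K + d), c k) * (w (K + d) : ℂ)) +
          (∑ k ∈ Finset.range (K + d + 1), c k) * ((w (K + d) - w (K + d + 1) : ℝ) : ℂ) := by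
        rw [← add_assoc, Finset.sum_range_succ, Finset.sum_range_succ]
        push_cast
        ring
      rw [hstep]
      refine (norm_add_le _ _).trans ?_
      have h1 : ‖(∑ k ∈ Finset.range (K + d + 1), c k) *
          ((w (K + d) - w (K + d + 1) : ℝ) : ℂ)‖ ≤ C * (w (K + d) - w (K + d + 1)) := by
        have hnn : 0 ≤ w (K + d) - w (K + d + 1) := sub_nonneg.2 (hw _ (by omega))
        rw [norm_mul, Complex.norm_real, Real.norm_eq_abs, abs_of_nonneg hnn]
        exact mul_le_mul_of_nonneg_right (hC _) hnn
      have : w (K + (d + 1)) = w (K + d + 1) := rfl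
      rw [this]
      linarith
  have key2 : ∀ d : ℕ, ‖(∑ k ∈ Finset.range (d + K), c k * (w k : ℂ) -
      ∑ k ∈ Finset.range K, c k * (w k : ℂ))‖ ≤ 2 * C * w K := by
    intro d
    rw [add_comm d K]
    have h1 := key d
    have h2 : ‖(∑ k ∈ Finset.range (K + d), c k) * (w (K + d) : ℂ)‖ ≤ C * w (K + d) := by
      rw [norm_mul, Complex.norm_real, Real.norm_eq_abs, abs_of_nonneg (h0 _ (by omega))]
      exact mul_le_mul_of_nonneg_right (hC _) (h0 _ (by omega))
    have h3 := norm_add_le ((∑ k ∈ Finset.range (K + d), c k * (w k : ℂ) -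
      ∑ k ∈ Finset.range K, c k * (w k : ℂ)) -
      (∑ k ∈ Finset.range (K + d), c k) * (w (K + d) : ℂ))
      ((∑ k ∈ Finset.range (K + d), c k) * (w (K + d) : ℂ))
    rw [sub_add_cancel] at h3
    linarith
  have ht := ((tendsto_add_atTop_iff_nat K).2 hS.tendsto_sum_nat).sub_const
    (∑ k ∈ Finset.range K, c k * (w k : ℂ))
  exact le_of_tendsto ht.norm (Eventually.of_forall key2)

/-- Partial sums of a nontrivial Dirichlet character are bounded. -/
lemma char_sum_bounded {n : ℕ} [NeZero n] (ψ : DirichletCharacter ℂ n) (hψ : ψ ≠ 1) :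
    ∃ C : ℝ, ∀ M, ‖∑ k ∈ Finset.range M, ψ (k : ZMod n)‖ ≤ C := by
  have hn : 0 < n := Nat.pos_of_ne_zero (NeZero.ne n)
  have hfull : ∑ k ∈ Finset.range n, ψ (k : ZMod n) = 0 := by
    rw [← MulChar.sum_eq_zero_of_ne_one hψ]
    refine Finset.sum_bij (fun k _ => (k : ZMod n)) (by simp) ?_ ?_ (by simp)
    · intro a ha b hb h
      rw [Finset.mem_range] at ha hb
      exact Nat.ModEq.eq_of_lt_of_lt ((ZMod.natCast_eq_natCast_iff _ _ _).1 h) ha hb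
    · intro b _
      exact ⟨b.val, Finset.mem_range.2 (ZMod.val_lt b), ZMod.natCast_zmod_val b⟩
  have hper : ∀ M, ∑ k ∈ Finset.range (M + n), ψ (k : ZMod n) =
      ∑ k ∈ Finset.range M, ψ (k : ZMod n) := by
    intro M
    rw [add_comm, Finset.sum_range_add, hfull, zero_add]
    simp
  refine ⟨∑ M ∈ Finset.range n, ‖∑ k ∈ Finset.range M, ψ (k : ZMod n)‖, fun M => ?_⟩
  induction M using Nat.strong_induction_on with
  | _ M ih =>
    by_cases hM : M < n
    · exact Finset.single_le_sum (f := fun M => ‖∑ k ∈ Finset.range M, ψ (k : ZMod n)‖)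
        (fun _ _ => norm_nonneg _) (Finset.mem_range.2 hM)
    · have := hper (M - n)
      rw [Nat.sub_add_cancel (by omega)] at this
      rw [this]
      exact ih _ (by omega)

open Filter Topology in
lemma abel_L {n : ℕ} [NeZero n] (ψ : DirichletCharacter ℂ n) (hψ : ψ ≠ 1) :
    Tendsto (fun K : ℕ => ∑ k ∈ Finset.range K, ψ (k : ZMod n) * (((k : ℝ)⁻¹ : ℝ) : ℂ)) atTop
      (𝓝 (DirichletCharacter.LFunction ψ 1)) := by
  obtain ⟨C, hC⟩ := char_sum_bounded ψ hψ
  have hn1 : n ≠ 1 := by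
    rintro rfl
    exact hψ (Subsingleton.elim _ _)
  have h0 : ψ ((0 : ℕ) : ZMod n) = 0 := by
    rw [Nat.cast_zero]
    apply MulChar.map_nonunit
    have : Nontrivial (ZMod n) := ZMod.nontrivial_iff.2 hn1
    exact not_isUnit_zero
  have hlim : Tendsto (fun s : ℝ => DirichletCharacter.LFunction ψ (s : ℂ)) (𝓝[>] 1)
      (𝓝 (DirichletCharacter.LFunction ψ 1)) := by
    have hc : Continuous (DirichletCharacter.LFunction ψ) :=
      (DirichletCharacter.differentiable_LFunction hψ).continuous
    have : Tendsto (fun s : ℝ => DirichletCharacter.LFunction ψ (s : ℂ)) (𝓝 1)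
      (𝓝 (DirichletCharacter.LFunction ψ ((1 : ℝ) : ℂ))) :=
      (hc.comp Complex.continuous_ofReal).tendsto 1
    rw [Complex.ofReal_one] at this
    exact this.mono_left nhdsWithin_le_nhds
  have hb : ∀ K : ℕ, 1 ≤ K → ‖DirichletCharacter.LFunction ψ 1 -
      ∑ k ∈ Finset.range K, ψ (k : ZMod n) * (((k : ℝ)⁻¹ : ℝ) : ℂ)‖ ≤ 2 * C * (K : ℝ)⁻¹ := by
    intro K hK
    have hpart : Tendsto (fun s : ℝ => ∑ k ∈ Finset.range K, ψ (k : ZMod n) *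
        (((k : ℝ) ^ (-s) : ℝ) : ℂ)) (𝓝[>] 1)
        (𝓝 (∑ k ∈ Finset.range K, ψ (k : ZMod n) * (((k : ℝ)⁻¹ : ℝ) : ℂ))) := by
      refine tendsto_finsetSum _ fun k _ => ?_
      rcases Nat.eq_zero_or_pos k with rfl | hk
      · simp only [h0, zero_mul]; exact tendsto_const_nhds
      · refine Tendsto.const_mul _ ?_
        refine (Complex.continuous_ofReal.tendsto _).comp ?_
        have : Tendsto (fun s : ℝ => (k : ℝ) ^ (-s)) (𝓝 1) (𝓝 ((k : ℝ) ^ (-(1 : ℝ)))) := by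
          have hk' : (k : ℝ) ≠ 0 := by positivity
          exact ((Real.continuous_const_rpow hk').comp continuous_neg).tendsto 1
        rw [Real.rpow_neg_one] at this
        exact this.mono_left nhdsWithin_le_nhds
    have hK' : Tendsto (fun s : ℝ => 2 * C * (K : ℝ) ^ (-s)) (𝓝[>] 1) (𝓝 (2 * C * (K : ℝ)⁻¹)) := by
      refine Tendsto.const_mul _ ?_
      have : Tendsto (fun s : ℝ => (K : ℝ) ^ (-s)) (𝓝 1) (𝓝 ((K : ℝ) ^ (-(1 : ℝ)))) := by
        have hk' : (K : ℝ) ≠ 0 := by positivity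
        exact ((Real.continuous_const_rpow hk').comp continuous_neg).tendsto 1
      rw [Real.rpow_neg_one] at this
      exact this.mono_left nhdsWithin_le_nhds
    refine le_of_tendsto_of_tendsto (hlim.sub hpart).norm hK' ?_
    filter_upwards [self_mem_nhdsWithin] with s hs
    have hs1 : 1 < s := hs
    refine tail_bound (fun k => ψ (k : ZMod n)) C hC (fun k => (k : ℝ) ^ (-s)) K ?_ ?_ _ ?_
    · intro k hk
      have hk0 : (0 : ℝ) < k := by exact_mod_cast (by omega : 0 < k)
      exact Real.rpow_le_rpow_of_nonpos hk0 (by push_cast; linarith) (by linarith)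
    · intro k _
      positivity
    · have hs2 : 1 < (s : ℂ).re := by simpa using hs1
      rw [DirichletCharacter.LFunction_eq_LSeries ψ hs2]
      have hsum := (DirichletCharacter.LSeriesSummable_of_one_lt_re ψ hs2).LSeriesHasSum
      have he : (fun k : ℕ => ψ (k : ZMod n) * (((k : ℝ) ^ (-s) : ℝ) : ℂ)) =
          LSeries.term (fun k => ψ (k : ZMod n)) (s : ℂ) := by
        funext k
        rw [LSeries.term_def]
        split_ifs with hk
        · subst hk
          rw [h0, zero_mul]
        · rw [Complex.ofReal_cpow (Nat.cast_nonneg k)]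
          push_cast
          rw [Complex.cpow_neg, div_eq_mul_inv]
      rw [he]
      exact hsum
  rw [tendsto_iff_norm_sub_tendsto_zero]
  refine squeeze_zero' (Eventually.of_forall fun _ => norm_nonneg _)
    (g := fun K : ℕ => 2 * C * (K : ℝ)⁻¹) ?_ ?_
  · filter_upwards [eventually_ge_atTop 1] with K hK
    rw [norm_sub_rev]
    exact hb K hK
  · simpa using (tendsto_inv_atTop_nhds_zero_nat (𝕜 := ℝ)).const_mul (2 * C)

open Filter Topology in
/-- The Abel means of `∑ ψ(m)/m` cannot tend to zero. -/
lemma abel_ne_zero {n : ℕ} [NeZero n] (ψ : DirichletCharacter ℂ n) (hψ : ψ ≠ 1)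
    (h : Tendsto (fun r : ℝ => ∑' m : ℕ, ψ (m : ZMod n) * ((r ^ m / m : ℝ) : ℂ)) (𝓝[<] 1)
      (𝓝 0)) : False := by
  have hL := abel_L ψ hψ
  have h1 := Complex.tendsto_tsum_powerSeries_nhdsWithin_lt hL
  have h2 : Tendsto (fun r : ℝ => ∑' m : ℕ, ψ (m : ZMod n) * ((r ^ m / m : ℝ) : ℂ)) (𝓝[<] 1)
      (𝓝 (DirichletCharacter.LFunction ψ 1)) := by
    rw [tendsto_map'_iff] at h1
    refine h1.congr fun r => ?_
    simp only [Function.comp_apply]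
    refine tsum_congr fun m => ?_
    push_cast
    ring
  exact DirichletCharacter.LFunction_apply_one_ne_zero hψ (tendsto_nhds_unique h2 h)


section Finite

variable {Q : Type*} [AddCommGroup Q] [Fintype Q] [DecidableEq Q]

lemma char_pow_card (χ : AddChar Q ℂ) (a : Q) : χ a ^ Fintype.card Q = 1 := by
  rw [← AddChar.map_nsmul_eq_pow, card_nsmul_eq_zero, AddChar.map_zero_eq_one]

lemma char_norm (χ : AddChar Q ℂ) (a : Q) : ‖χ a‖ = 1 :=
  Complex.norm_eq_one_of_pow_eq_one (char_pow_card χ a) Fintype.card_ne_zero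

lemma one_add_char_ne_zero (hodd : Odd (Fintype.card Q)) (χ : AddChar Q ℂ) (a : Q) :
    1 + χ a ≠ 0 := by
  intro h
  have h1 : χ a = -1 := by linear_combination h
  have h2 := char_pow_card χ a
  rw [h1, hodd.neg_one_pow] at h2
  norm_num at h2

lemma char_pow_eq_one_iff (u : ℕ) (hu : Nat.Coprime u (Fintype.card Q)) (χ : AddChar Q ℂ) (a : Q) :
    χ a ^ u = 1 ↔ χ a = 1 := by
  constructor
  · intro h
    have h1 := orderOf_dvd_of_pow_eq_one h
    have h2 := orderOf_dvd_of_pow_eq_one (char_pow_card χ a)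
    have := Nat.dvd_gcd h1 h2
    rw [hu.gcd_eq_one] at this
    exact orderOf_eq_one_iff.1 (Nat.dvd_one.1 this)
  · intro h; rw [h, one_pow]

lemma prod_one_add_char (χ : AddChar Q ℂ) (A : Multiset Q) :
    (A.map (fun a => 1 + χ a)).prod = ((FS A).map χ).sum := by
  induction A using Multiset.induction_on with
  | empty => simp [FS_zero]
  | cons a A ih =>
    rw [Multiset.map_cons, Multiset.prod_cons, ih, FS_cons, Multiset.map_add, Multiset.sum_add,
      Multiset.map_map]
    have : (χ ∘ fun x => a + x) = fun x => χ a * χ x := by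
      funext x
      simp [AddChar.map_add_eq_mul]
    rw [this, Multiset.sum_map_mul_left]
    ring

lemma sum_log_char (hodd : Odd (Fintype.card Q)) (χ : AddChar Q ℂ) (A : Multiset Q) :
    (A.map (fun a => Real.log ‖1 + χ a‖)).sum = Real.log ‖(A.map (fun a => 1 + χ a)).prod‖ := by
  induction A using Multiset.induction_on with
  | empty => simp
  | cons a A ih =>
    rw [Multiset.map_cons, Multiset.sum_cons, ih, Multiset.map_cons, Multiset.prod_cons, norm_mul,
      Real.log_mul]
    · exact norm_ne_zero_iff.2 (one_add_char_ne_zero hodd χ a)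
    · rw [norm_ne_zero_iff]
      intro h
      obtain ⟨b, -, hb⟩ := Multiset.mem_map.1 (Multiset.prod_eq_zero_iff.1 h)
      exact one_add_char_ne_zero hodd χ b hb

lemma sum_count_mul (A : Multiset Q) (w : Q → ℝ) :
    ∑ a, (A.count a : ℝ) * w a = (A.map w).sum := by
  induction A using Multiset.induction_on with
  | empty => simp
  | cons b A ih =>
    rw [Multiset.map_cons, Multiset.sum_cons, ← ih]
    simp [Multiset.count_cons, add_mul, Finset.sum_add_distrib, add_comm]

/-- Symmetrized difference of multiplicities. -/
def symc {G : Type*} [AddCommGroup G] [DecidableEq G] (A A' : Multiset G) (a : G) : ℝ :=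
  (A.count a + A.count (-a) : ℝ) - (A'.count a + A'.count (-a))


lemma symc_neg (A A' : Multiset Q) (a : Q) : symc A A' (-a) = symc A A' a := by
  simp only [symc, neg_neg]
  ring

lemma symc_sum (hodd : Odd (Fintype.card Q)) (A A' : Multiset Q) (h : FS A = FS A')
    (χ : AddChar Q ℂ) : ∑ a, symc A A' a * Real.log ‖1 + χ a‖ = 0 := by
  have h1 : ∀ B : Multiset Q, ∑ a, (B.count (-a) : ℝ) * Real.log ‖1 + χ a‖ =
      ∑ a, (B.count a : ℝ) * Real.log ‖1 + χ a‖ := by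
    intro B
    refine Fintype.sum_equiv (Equiv.neg Q) _ _ fun a => ?_
    rw [Equiv.neg_apply, AddChar.map_neg_eq_conj]
    congr 2
    rw [← Complex.norm_conj]
    simp
  have h2 : ∀ B : Multiset Q, ∑ a, (B.count a : ℝ) * Real.log ‖1 + χ a‖ =
      Real.log ‖((FS B).map χ).sum‖ := by
    intro B
    rw [sum_count_mul, sum_log_char hodd, prod_one_add_char]
  simp only [symc, sub_mul, add_mul, Finset.sum_add_distrib, Finset.sum_sub_distrib, h1, h2, h]
  ring

lemma log_step (z : ℂ) (hz : 1 + z ≠ 0) :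
    Real.log ‖1 + z‖ = Real.log ‖1 - z ^ 2‖ - Real.log ‖1 - z‖ +
      (if z = 1 then Real.log 2 else 0) := by
  split_ifs with h
  · subst h
    norm_num
  · have h1 : 1 - z ≠ 0 := fun h' => h (by linear_combination -h')
    have : 1 - z ^ 2 = (1 + z) * (1 - z) := by ring
    rw [this, norm_mul, Real.log_mul (norm_ne_zero_iff.2 hz) (norm_ne_zero_iff.2 h1)]
    ring

/-- Doubling as a permutation. -/
noncomputable def dbl (hodd : Odd (Fintype.card Q)) : Q ≃ Q :=
  nsmulCoprime (G := Q) (n := 2)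
    (by rw [Nat.card_eq_fintype_card]; exact (Nat.coprime_two_right).2 hodd)


lemma dbl_apply (hodd : Odd (Fintype.card Q)) (a : Q) : dbl hodd a = 2 • a := rfl

lemma char_dbl (hodd : Odd (Fintype.card Q)) (χ : AddChar Q ℂ) (a : Q) :
    χ (dbl hodd a) = χ a ^ 2 := by
  rw [dbl_apply, AddChar.map_nsmul_eq_pow]

/-- `g = h ∘ half - h`. -/
noncomputable def gfun (hodd : Odd (Fintype.card Q)) (h : Q → ℝ) (a : Q) : ℝ :=
  h ((dbl hodd).symm a) - h a

lemma gfun_neg (hodd : Odd (Fintype.card Q)) (h : Q → ℝ) (hev : ∀ a, h (-a) = h a) (a : Q) :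
    gfun hodd h (-a) = gfun hodd h a := by
  have : (dbl hodd).symm (-a) = -(dbl hodd).symm a := by
    rw [Equiv.symm_apply_eq, dbl_apply, smul_neg, ← dbl_apply hodd, Equiv.apply_symm_apply]
  rw [gfun, gfun, this, hev, hev]

lemma gfun_sum (hodd : Odd (Fintype.card Q)) (h : Q → ℝ) (F : Q → ℝ) :
    ∑ a, gfun hodd h a * F a = ∑ a, h a * F (dbl hodd a) - ∑ a, h a * F a := by
  simp only [gfun, sub_mul, Finset.sum_sub_distrib]
  congr 1
  symm
  refine Fintype.sum_equiv (dbl hodd) _ _ fun a => ?_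
  rw [Equiv.symm_apply_apply]

lemma gfun_ker (hodd : Odd (Fintype.card Q)) (h : Q → ℝ) (χ : AddChar Q ℂ) :
    ∑ a, gfun hodd h a * (if χ a = 1 then 1 else 0) = 0 := by
  rw [gfun_sum, sub_eq_zero]
  refine Finset.sum_congr rfl fun a _ => ?_
  rw [char_dbl]
  simp only [char_pow_eq_one_iff 2 (Nat.coprime_two_left.2 hodd)]

/-- The log-sum of `g`. -/
lemma gfun_log (hodd : Odd (Fintype.card Q)) (h : Q → ℝ)
    (hE : ∀ χ : AddChar Q ℂ, ∑ a, h a * Real.log ‖1 + χ a‖ = 0) (χ : AddChar Q ℂ) :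
    ∑ a, gfun hodd h a * Real.log ‖1 - χ a‖ =
      -Real.log 2 * ∑ a, h a * (if χ a = 1 then 1 else 0) := by
  rw [gfun_sum]
  have h1 := hE χ
  have h2 : ∀ a, h a * Real.log ‖1 + χ a‖ = h a * Real.log ‖1 - χ (dbl hodd a)‖ -
      h a * Real.log ‖1 - χ a‖ + Real.log 2 * (h a * (if χ a = 1 then 1 else 0)) := by
    intro a
    rw [log_step _ (one_add_char_ne_zero hodd χ a), char_dbl]
    split_ifs <;> ring
  simp only [h2, Finset.sum_add_distrib, Finset.sum_sub_distrib, ← Finset.mul_sum] at h1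
  linarith

/-- The regularized sum is real: complex logs may be replaced by real ones. -/
lemma real_log_sum (g : Q → ℝ) (hg : ∀ a, g (-a) = g a) (χ : AddChar Q ℂ) (r : ℝ) (hr0 : 0 < r)
    (hr : r < 1) : ∑ a, (g a : ℂ) * Complex.log (1 - r * χ a) =
      ((∑ a, g a * Real.log ‖1 - r * χ a‖ : ℝ) : ℂ) := by
  have hslit : ∀ a, (1 - r * χ a).arg ≠ Real.pi := by
    intro a
    have : 1 - r * χ a ∈ Complex.slitPlane := by
      left
      have h1 : (χ a).re ≤ 1 := (Complex.re_le_norm _).trans (char_norm χ a).le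
      simp
      nlinarith
    exact Complex.slitPlane_arg_ne_pi this
  have hconj : (starRingEnd ℂ) (∑ a, (g a : ℂ) * Complex.log (1 - r * χ a)) =
      ∑ a, (g a : ℂ) * Complex.log (1 - r * χ a) := by
    rw [map_sum]
    refine Fintype.sum_equiv (Equiv.neg Q) _ _ fun a => ?_
    rw [Equiv.neg_apply, hg, AddChar.map_neg_eq_conj, map_mul, Complex.conj_ofReal,
      ← Complex.log_conj _ (hslit a)]
    simp
  rw [Complex.conj_eq_iff_re] at hconj
  rw [← hconj, Complex.re_sum]
  congr 1
  refine Finset.sum_congr rfl fun a _ => ?_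
  rw [Complex.re_ofReal_mul, Complex.log_re]

/-- Regularized Fourier coefficient. -/
noncomputable def Vfun (g : Q → ℝ) (r : ℝ) (b : Q) : ℂ :=
  ∑ χ : AddChar Q ℂ, χ (-b) * ((∑ a, g a * Real.log ‖1 - r * χ a‖ : ℝ) : ℂ)

lemma Vfun_hasSum (g : Q → ℝ) (hg : ∀ a, g (-a) = g a) (r : ℝ) (hr0 : 0 < r)
    (hr : r < 1) (b : Q) :
    HasSum (fun m : ℕ => (Fintype.card Q : ℂ) * (∑ a, if m • a = b then (g a : ℂ) else 0) *
      ((r ^ m / m : ℝ) : ℂ)) (-Vfun g r b) := by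
  have h1 : ∀ χ : AddChar Q ℂ, HasSum (fun m : ℕ => ∑ a, χ (-b) * ((g a : ℂ) *
      ((r * χ a) ^ m / m))) (∑ a, χ (-b) * ((g a : ℂ) * (-Complex.log (1 - r * χ a)))) := by
    intro χ
    refine hasSum_sum fun a _ => ?_
    refine ((Complex.hasSum_taylorSeries_neg_log ?_).mul_left _).mul_left _
    rw [norm_mul, char_norm, mul_one, Complex.norm_real, Real.norm_eq_abs, abs_of_pos hr0]
    exact hr
  have h2 := hasSum_sum (s := Finset.univ) fun χ _ => h1 χ
  convert h2 using 1
  · funext m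
    rw [Finset.sum_comm]
    rw [Finset.mul_sum, Finset.sum_mul]
    refine Finset.sum_congr rfl fun a _ => ?_
    have h3 : ∀ χ : AddChar Q ℂ, χ (-b) * ((g a : ℂ) * ((r * χ a) ^ m / m)) =
        χ (m • a - b) * ((g a : ℂ) * ((r ^ m / m : ℝ) : ℂ)) := by
      intro χ
      rw [sub_eq_add_neg, AddChar.map_add_eq_mul, AddChar.map_nsmul_eq_pow]
      push_cast
      ring
    simp only [h3]
    rw [← Finset.sum_mul, AddChar.sum_apply_eq_ite]
    simp only [sub_eq_zero]
    split_ifs <;> ring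
  · rw [Vfun, ← Finset.sum_neg_distrib]
    refine Finset.sum_congr rfl fun χ _ => ?_
    rw [← real_log_sum g hg χ r hr0 hr, ← Finset.mul_sum]
    simp

end Finite

section FiniteLimit

open Filter Topology

variable {Q : Type*} [AddCommGroup Q] [Fintype Q] [DecidableEq Q]

/-- The limiting Fourier coefficient. -/
noncomputable def Wfun (g : Q → ℝ) (b : Q) : ℂ :=
  ∑ χ : AddChar Q ℂ, χ (-b) * ((∑ a, g a * Real.log ‖1 - χ a‖ : ℝ) : ℂ)

lemma Vfun_tendsto (hodd : Odd (Fintype.card Q)) (h : Q → ℝ) (b : Q) :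
    Tendsto (fun r : ℝ => Vfun (gfun hodd h) r b) (𝓝[<] 1) (𝓝 (Wfun (gfun hodd h) b)) := by
  unfold Vfun Wfun
  refine tendsto_finsetSum _ fun χ _ => Tendsto.const_mul _ ?_
  refine (Complex.continuous_ofReal.tendsto _).comp ?_
  have h1 : ∀ r : ℝ, ∑ a, gfun hodd h a * Real.log ‖1 - r * χ a‖ =
      ∑ a, gfun hodd h a * (if χ a = 1 then 0 else Real.log ‖1 - r * χ a‖) := by
    intro r
    have h2 := gfun_ker hodd h χ
    have h3 : ∀ a, gfun hodd h a * Real.log ‖1 - r * χ a‖ =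
        gfun hodd h a * (if χ a = 1 then 0 else Real.log ‖1 - r * χ a‖) +
        Real.log ‖1 - (r : ℂ)‖ * (gfun hodd h a * (if χ a = 1 then 1 else 0)) := by
      intro a
      split_ifs with h
      · rw [h]; simp; ring
      · ring
    simp only [h3, Finset.sum_add_distrib, ← Finset.mul_sum, h2]
    ring
  have h4 : ∑ a, gfun hodd h a * Real.log ‖1 - χ a‖ =
      ∑ a, gfun hodd h a * (if χ a = 1 then 0 else Real.log ‖1 - ((1 : ℝ) : ℂ) * χ a‖) := by
    refine Finset.sum_congr rfl fun a _ => ?_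
    split_ifs with h
    · simp [h]
    · simp
  simp only [h1]
  rw [h4]
  refine tendsto_nhdsWithin_of_tendsto_nhds ?_
  refine tendsto_finsetSum _ fun a _ => Tendsto.const_mul _ ?_
  split_ifs with h
  · exact tendsto_const_nhds
  · refine Tendsto.log ?_ ?_
    · have : Continuous fun r : ℝ => ‖1 - (r : ℂ) * χ a‖ := by fun_prop
      exact this.tendsto 1
    · rw [norm_ne_zero_iff]
      intro h'
      apply h
      push_cast at h'
      linear_combination -h'

lemma Wfun_unit (hodd : Odd (Fintype.card Q)) (h : Q → ℝ)
    (hE : ∀ χ : AddChar Q ℂ, ∑ a, h a * Real.log ‖1 + χ a‖ = 0)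
    (u : ℕ) (hu : Nat.Coprime u (Fintype.card Q)) (b : Q) :
    Wfun (gfun hodd h) (u • b) = Wfun (gfun hodd h) b := by
  unfold Wfun
  have hc : (Nat.card (AddChar Q ℂ)).Coprime u := by
    rw [Nat.card_eq_fintype_card, AddChar.card_eq]; exact hu.symm
  refine Fintype.sum_equiv (powCoprime hc) _ _ fun χ => ?_
  rw [gfun_log hodd h hE, gfun_log hodd h hE]
  have h1 : (powCoprime hc) χ = χ ^ u := rfl
  simp only [h1, AddChar.pow_apply, char_pow_eq_one_iff u hu]
  rw [← AddChar.map_nsmul_eq_pow, smul_neg]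

end FiniteLimit

section FiniteOrbit

open Filter Topology

variable {Q : Type*} [AddCommGroup Q]

/-- multiples of `b` indexed by residues modulo the order -/
def orb {n : ℕ} (b : Q) (x : ZMod n) : Q := x.val • b

lemma orb_natCast {n : ℕ} (b : Q) (hn : addOrderOf b = n) (k : ℕ) :
    orb b (k : ZMod n) = k • b := by
  rw [orb, ZMod.val_natCast, ← hn, mod_addOrderOf_nsmul]

lemma nsmul_orb {n : ℕ} [NeZero n] (b : Q) (hn : addOrderOf b = n) (m : ℕ) (x : ZMod n) :
    m • orb b x = orb b ((m : ZMod n) * x) := by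
  have : (m : ZMod n) * x = ((m * x.val : ℕ) : ZMod n) := by
    push_cast
    rw [ZMod.natCast_zmod_val]
  rw [this, orb_natCast b hn, orb, mul_nsmul']

lemma orb_injective {n : ℕ} [NeZero n] (b : Q) (hn : addOrderOf b = n) :
    Function.Injective (orb b : ZMod n → Q) := by
  intro x y hxy
  rw [orb, orb, nsmul_eq_nsmul_iff_modEq, hn, ← ZMod.natCast_eq_natCast_iff] at hxy
  simpa using hxy

lemma addOrderOf_orb {n : ℕ} [NeZero n] (b : Q) (hn : addOrderOf b = n) (v : (ZMod n)ˣ) :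
    addOrderOf (orb b (v : ZMod n)) = n := by
  rw [orb, Nat.Coprime.addOrderOf_nsmul, hn]
  rw [hn]
  exact (ZMod.val_coe_unit_coprime v).symm

lemma orb_lift {n : ℕ} [NeZero n] (b : Q) (hn : addOrderOf b = n) (m : ℕ) (v : (ZMod n)ˣ) (a : Q)
    (hma : m • a = orb b (v : ZMod n)) (ha : addOrderOf a ≤ n) (ha0 : 0 < addOrderOf a) :
    ∃ w : (ZMod n)ˣ, orb b (w : ZMod n) = a := by
  have hv := addOrderOf_orb b hn v
  have h1 : addOrderOf (m • a) ∣ addOrderOf a := addOrderOf_smul_dvd m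
  have h2 : addOrderOf a = n := by
    refine le_antisymm ha ?_
    rw [hma, hv] at h1
    exact Nat.le_of_dvd ha0 h1
  have hco : Nat.Coprime m n := by
    have h3 : addOrderOf (m • a) = addOrderOf a / Nat.gcd (addOrderOf a) m :=
      (addOrderOf_pos_iff.1 ha0).addOrderOf_nsmul _ _
    rw [hma, hv, h2] at h3
    have h4 : Nat.gcd n m ∣ n := Nat.gcd_dvd_left _ _
    have h5 := Nat.div_mul_cancel h4
    rw [← h3] at h5
    have h6 : Nat.gcd n m = 1 := Nat.eq_of_mul_eq_mul_left (NeZero.pos n) (by rw [h5, mul_one])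
    rw [Nat.coprime_comm]; exact h6
  refine ⟨(ZMod.unitOfCoprime m hco)⁻¹ * v, ?_⟩
  have h7 : ((ZMod.unitOfCoprime m hco)⁻¹ : (ZMod n)ˣ).val.val • m • a = a := by
    rw [smul_smul]
    conv_rhs => rw [← one_nsmul a]
    rw [nsmul_eq_nsmul_iff_modEq, h2, ← ZMod.natCast_eq_natCast_iff]
    push_cast
    rw [ZMod.natCast_zmod_val]
    have := (ZMod.unitOfCoprime m hco).inv_mul
    rwa [ZMod.coe_unitOfCoprime] at this
  rw [hma, nsmul_orb b hn, ZMod.natCast_zmod_val] at h7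
  rw [← h7]
  simp

variable [Fintype Q] [DecidableEq Q]

lemma sum_orb {n : ℕ} [NeZero n] (b : Q) (hn : addOrderOf b = n) (g : Q → ℝ)
    (hmax : ∀ a, g a ≠ 0 → addOrderOf a ≤ n) (m : ℕ) (v : (ZMod n)ˣ) :
    ∑ a, (if m • a = orb b (v : ZMod n) then (g a : ℂ) else 0) =
      ∑ w : (ZMod n)ˣ, if (m : ZMod n) * w = v then (g (orb b (w : ZMod n)) : ℂ) else 0 := by
  symm
  refine Fintype.sum_of_injective (fun w : (ZMod n)ˣ => orb b (w : ZMod n)) ?_ _ _ ?_ ?_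
  · intro x y hxy
    exact Units.ext (orb_injective b hn hxy)
  · intro a ha
    split_ifs with hma
    · by_contra hg
      have hg' : g a ≠ 0 := by
        intro h; apply hg; rw [h]; simp
      obtain ⟨w, hw⟩ := orb_lift b hn m v a hma (hmax a hg') (addOrderOf_pos a)
      exact ha ⟨w, hw⟩
    · rfl
  · intro w
    simp only [nsmul_orb b hn, (orb_injective b hn).eq_iff]

/-- The character coefficient. -/
noncomputable def ghat {n : ℕ} [NeZero n] (b : Q) (g : Q → ℝ) (ψ : DirichletCharacter ℂ n) : ℂ :=
  ∑ w : (ZMod n)ˣ, ψ w * (g (orb b (w : ZMod n)) : ℂ)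

lemma sum_psi_orb {n : ℕ} [NeZero n] (b : Q) (hn : addOrderOf b = n) (g : Q → ℝ)
    (hmax : ∀ a, g a ≠ 0 → addOrderOf a ≤ n) (m : ℕ) (ψ : DirichletCharacter ℂ n) :
    ∑ v : (ZMod n)ˣ, ψ v * ∑ a, (if m • a = orb b (v : ZMod n) then (g a : ℂ) else 0) =
      ψ (m : ZMod n) * ghat b g ψ := by
  simp only [sum_orb b hn g hmax, Finset.mul_sum, ghat]
  rw [Finset.sum_comm]
  refine Finset.sum_congr rfl fun w _ => ?_
  by_cases hm : IsUnit (m : ZMod n)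
  · obtain ⟨u, hu⟩ := hm
    rw [← hu]
    have : ∀ v : (ZMod n)ˣ, ((u : ZMod n) * w = v) ↔ u * w = v := by
      intro v
      rw [← Units.val_mul, Units.val_inj]
    simp only [this]
    rw [Finset.sum_eq_single (u * w)]
    · rw [if_pos rfl, Units.val_mul, map_mul]; ring
    · intro v _ hv
      rw [if_neg (Ne.symm hv), mul_zero]
    · simp
  · rw [ψ.map_nonunit hm, zero_mul]
    refine Finset.sum_eq_zero fun v _ => ?_
    rw [if_neg, mul_zero]
    intro h
    apply hm
    have : IsUnit ((m : ZMod n) * w) := by rw [h]; exact v.isUnit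
    exact isUnit_of_mul_isUnit_left this

lemma Wfun_orb (hodd : Odd (Fintype.card Q)) (h : Q → ℝ)
    (hE : ∀ χ : AddChar Q ℂ, ∑ a, h a * Real.log ‖1 + χ a‖ = 0)
    {n : ℕ} [NeZero n] (b : Q) (hn : addOrderOf b = n) (v : (ZMod n)ˣ) :
    Wfun (gfun hodd h) (orb b (v : ZMod n)) = Wfun (gfun hodd h) b := by
  have hd : n ∣ Fintype.card Q := hn ▸ addOrderOf_dvd_card
  have : NeZero (Fintype.card Q) := ⟨Fintype.card_ne_zero⟩
  obtain ⟨u, hu⟩ := ZMod.unitsMap_surjective hd v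
  have : orb b (v : ZMod n) = (u : ZMod (Fintype.card Q)).val • b := by
    rw [← orb_natCast b hn, ← hu, ZMod.unitsMap_val, ZMod.natCast_val]
  rw [this]
  exact Wfun_unit hodd h hE _ (ZMod.val_coe_unit_coprime u) b

lemma ghat_eq_zero (hodd : Odd (Fintype.card Q)) (h : Q → ℝ) (hev : ∀ a, h (-a) = h a)
    (hE : ∀ χ : AddChar Q ℂ, ∑ a, h a * Real.log ‖1 + χ a‖ = 0)
    {n : ℕ} [NeZero n] (b : Q) (hn : addOrderOf b = n)
    (hmax : ∀ a, gfun hodd h a ≠ 0 → addOrderOf a ≤ n) (ψ : DirichletCharacter ℂ n) (hψ : ψ ≠ 1) :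
    ghat b (gfun hodd h) ψ = 0 := by
  by_contra hne
  set g := gfun hodd h with hg
  have hN : (Fintype.card Q : ℂ) ≠ 0 := by exact_mod_cast Fintype.card_ne_zero
  refine abel_ne_zero ψ hψ ?_
  have h1 : ∀ r : ℝ, 0 < r → r < 1 → ∑' m : ℕ, ψ (m : ZMod n) * ((r ^ m / m : ℝ) : ℂ) =
      ((Fintype.card Q : ℂ) * ghat b g ψ)⁻¹ *
        ∑ v : (ZMod n)ˣ, ψ v * -Vfun g r (orb b (v : ZMod n)) := by
    intro r hr0 hr1
    have h2 := hasSum_sum (s := Finset.univ) fun (v : (ZMod n)ˣ) _ =>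
      (Vfun_hasSum g (gfun_neg hodd h hev) r hr0 hr1 (orb b (v : ZMod n))).mul_left (ψ v)
    have h3 := h2.mul_left (((Fintype.card Q : ℂ) * ghat b g ψ)⁻¹)
    rw [← h3.tsum_eq]
    refine tsum_congr fun m => ?_
    have h4 := sum_psi_orb b hn g hmax m ψ
    have h5 : ∑ v : (ZMod n)ˣ, ψ v * ((Fintype.card Q : ℂ) *
        (∑ a, if m • a = orb b (v : ZMod n) then (g a : ℂ) else 0) * ((r ^ m / m : ℝ) : ℂ)) =
        (Fintype.card Q : ℂ) * ((r ^ m / m : ℝ) : ℂ) * (ψ (m : ZMod n) * ghat b g ψ) := by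
      rw [← h4, Finset.mul_sum]
      refine Finset.sum_congr rfl fun v _ => ?_
      ring
    rw [h5]
    field_simp
  have h6 : Tendsto (fun r : ℝ => ((Fintype.card Q : ℂ) * ghat b g ψ)⁻¹ *
        ∑ v : (ZMod n)ˣ, ψ v * -Vfun g r (orb b (v : ZMod n))) (𝓝[<] 1)
        (𝓝 (((Fintype.card Q : ℂ) * ghat b g ψ)⁻¹ *
        ∑ v : (ZMod n)ˣ, ψ v * -Wfun g (orb b (v : ZMod n)))) := by
    refine Tendsto.const_mul _ (tendsto_finsetSum _ fun v _ => Tendsto.const_mul _ ?_)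
    exact (Vfun_tendsto hodd h _).neg
  have h7 : ∑ v : (ZMod n)ˣ, ψ v * -Wfun g (orb b (v : ZMod n)) = 0 := by
    simp only [hg, Wfun_orb hodd h hE b hn]
    rw [← Finset.sum_mul]
    have h8 : ∑ v : (ZMod n)ˣ, ψ v = 0 := by
      rw [← MulChar.sum_eq_zero_of_ne_one hψ]
      refine Fintype.sum_of_injective (fun v : (ZMod n)ˣ => (v : ZMod n)) Units.val_injective _ _
        ?_ (fun _ => rfl)
      intro x hx
      apply ψ.map_nonunit
      rintro ⟨u, rfl⟩
      exact hx ⟨u, rfl⟩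
    rw [h8, zero_mul]
  rw [h7, mul_zero] at h6
  refine h6.congr' ?_
  have h9 : Set.Ioo (0 : ℝ) 1 ∈ 𝓝[<] (1 : ℝ) := Ioo_mem_nhdsLT one_pos
  filter_upwards [h9] with r hr
  exact (h1 r hr.1 hr.2).symm

lemma ghat_one (hodd : Odd (Fintype.card Q)) (h : Q → ℝ)
    {n : ℕ} [NeZero n] (b : Q) (hn : addOrderOf b = n) :
    ghat b (gfun hodd h) (1 : DirichletCharacter ℂ n) = 0 := by
  have hd : n ∣ Fintype.card Q := hn ▸ addOrderOf_dvd_card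
  have hno : Odd n := hodd.of_dvd_nat hd
  have h2 : Nat.Coprime 2 n := Nat.coprime_two_left.2 hno
  simp only [ghat, gfun]
  have h3 : ∀ w : (ZMod n)ˣ, (dbl hodd).symm
      (orb b ((ZMod.unitOfCoprime 2 h2 * w : (ZMod n)ˣ) : ZMod n)) = orb b (w : ZMod n) := by
    intro w
    rw [Equiv.symm_apply_eq, dbl_apply, nsmul_orb b hn, Units.val_mul, ZMod.coe_unitOfCoprime]
  simp only [MulChar.one_apply_coe, one_mul, Complex.ofReal_sub, Finset.sum_sub_distrib]
  rw [sub_eq_zero]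
  symm
  refine Fintype.sum_equiv (Equiv.mulLeft (ZMod.unitOfCoprime 2 h2)) _ _ fun w => ?_
  rw [Equiv.coe_mulLeft, h3]

lemma gfun_eq_zero (hodd : Odd (Fintype.card Q)) (h : Q → ℝ) (hev : ∀ a, h (-a) = h a)
    (hE : ∀ χ : AddChar Q ℂ, ∑ a, h a * Real.log ‖1 + χ a‖ = 0) (a : Q) : gfun hodd h a = 0 := by
  by_contra ha
  obtain ⟨b, hb, hmax⟩ := Finset.exists_max_image (Finset.univ.filter fun a => gfun hodd h a ≠ 0)
    addOrderOf ⟨a, by simpa using ha⟩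
  simp only [Finset.mem_filter, Finset.mem_univ, true_and] at hb hmax
  obtain ⟨n, hn⟩ : ∃ n, addOrderOf b = n := ⟨_, rfl⟩
  have : NeZero n := ⟨by rw [← hn]; exact (addOrderOf_pos b).ne'⟩
  rw [hn] at hmax
  have h1 : ∀ ψ : DirichletCharacter ℂ n, ghat b (gfun hodd h) ψ = 0 := by
    intro ψ
    by_cases hψ : ψ = 1
    · rw [hψ]; exact ghat_one hodd h b hn
    · exact ghat_eq_zero hodd h hev hE b hn hmax ψ hψ
  have h2 : ∑ ψ : DirichletCharacter ℂ n, ghat b (gfun hodd h) ψ = 0 :=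
    Finset.sum_eq_zero fun ψ _ => h1 ψ
  simp only [ghat] at h2
  rw [Finset.sum_comm] at h2
  have h3 : ∀ w : (ZMod n)ˣ, ∑ ψ : DirichletCharacter ℂ n, ψ w =
      if w = 1 then (n.totient : ℂ) else 0 := by
    intro w
    rw [DirichletCharacter.sum_characters_eq]
    simp only [Units.val_eq_one]
  simp only [← Finset.sum_mul, h3] at h2
  simp only [ite_mul, zero_mul, Finset.sum_ite_eq', Finset.mem_univ, if_true] at h2
  have h4 : orb b ((1 : (ZMod n)ˣ) : ZMod n) = b := by
    have := orb_natCast b hn 1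
    simpa using this
  rw [h4, mul_eq_zero] at h2
  rcases h2 with h2 | h2
  · have : n.totient = 0 := by exact_mod_cast h2
    exact (Nat.totient_pos.2 (NeZero.pos n)).ne' this
  · exact hb (by exact_mod_cast h2)

/-- `Q1`. -/
lemma h_dbl (hodd : Odd (Fintype.card Q)) (h : Q → ℝ) (hev : ∀ a, h (-a) = h a)
    (hE : ∀ χ : AddChar Q ℂ, ∑ a, h a * Real.log ‖1 + χ a‖ = 0) (a : Q) : h (2 • a) = h a := by
  have := gfun_eq_zero hodd h hev hE (dbl hodd a)
  rw [gfun, Equiv.symm_apply_apply, dbl_apply] at this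
  linarith

end FiniteOrbit

section FiniteEnd

variable {Q : Type*} [AddCommGroup Q]

lemma coprime_of_addOrderOf (m : ℕ) (a : Q) (h : addOrderOf (m • a) = addOrderOf a)
    (ha0 : 0 < addOrderOf a) : Nat.Coprime m (addOrderOf a) := by
  have h3 : addOrderOf (m • a) = addOrderOf a / Nat.gcd (addOrderOf a) m :=
    (addOrderOf_pos_iff.1 ha0).addOrderOf_nsmul _ _
  rw [h] at h3
  have h5 := Nat.div_mul_cancel (Nat.gcd_dvd_left (addOrderOf a) m)
  rw [← h3] at h5
  have h6 : Nat.gcd (addOrderOf a) m = 1 := Nat.eq_of_mul_eq_mul_left ha0 (by rw [h5, mul_one])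
  rw [Nat.coprime_comm]; exact h6

lemma OFS_smul (m : ℕ) (a : Q) (hO : OFS (addOrderOf a)) (hm : Nat.Coprime m (addOrderOf a)) :
    ∃ j : ℕ, m • a = 2 ^ j • a ∨ m • a = -(2 ^ j • a) := by
  obtain ⟨j, hj⟩ := hO.2.2 m (Nat.isCoprime_iff_coprime.2 hm)
  refine ⟨j, ?_⟩
  rcases hj with hj | hj
  · left
    have := addOrderOf_dvd_iff_zsmul_eq_zero.1 hj
    rw [sub_zsmul, natCast_zsmul] at this
    have h2 : ((2 : ℤ) ^ j) • a = (2 ^ j : ℕ) • a := by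
      rw [← natCast_zsmul]; push_cast; rfl
    rw [h2] at this
    exact add_neg_eq_zero.1 this
  · right
    have := addOrderOf_dvd_iff_zsmul_eq_zero.1 hj
    rw [add_zsmul, natCast_zsmul] at this
    have h2 : ((2 : ℤ) ^ j) • a = (2 ^ j : ℕ) • a := by
      rw [← natCast_zsmul]; push_cast; rfl
    rw [h2] at this
    exact eq_neg_of_add_eq_zero_left this

lemma h_two_pow (h : Q → ℝ) (hd : ∀ a, h (2 • a) = h a) (j : ℕ) (a : Q) : h (2 ^ j • a) = h a := by
  induction j with
  | zero => simp
  | succ j ih => rw [pow_succ', mul_nsmul', hd, ih]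

variable [Fintype Q] [DecidableEq Q]

lemma ker_indicator (χ : AddChar Q ℂ) (a : Q) :
    ∑ m ∈ Finset.range (Fintype.card Q), χ ((m + 1) • a) =
      (Fintype.card Q : ℂ) * (if χ a = 1 then 1 else 0) := by
  simp only [AddChar.map_nsmul_eq_pow, pow_succ]
  rw [← Finset.sum_mul]
  split_ifs with h
  · simp [h]
  · rw [geom_sum_eq h, char_pow_card]; simp

lemma ker_sum_zero (hodd : Odd (Fintype.card Q)) (h : Q → ℝ) (hev : ∀ a, h (-a) = h a)
    (hE : ∀ χ : AddChar Q ℂ, ∑ a, h a * Real.log ‖1 + χ a‖ = 0) (χ : AddChar Q ℂ) :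
    ∑ a, h a * (if χ a = 1 then 1 else 0) = 0 := by
  have h1 := gfun_log hodd h hE χ
  simp only [gfun_eq_zero hodd h hev hE, zero_mul, Finset.sum_const_zero] at h1
  have h2 : Real.log 2 ≠ 0 := (Real.log_pos one_lt_two).ne'
  have := mul_eq_zero.1 h1.symm
  rcases this with h3 | h3
  · exact absurd (neg_eq_zero.1 h3) h2
  · exact h3

lemma mult_sum_zero (hodd : Odd (Fintype.card Q)) (h : Q → ℝ) (hev : ∀ a, h (-a) = h a)
    (hE : ∀ χ : AddChar Q ℂ, ∑ a, h a * Real.log ‖1 + χ a‖ = 0) (b : Q) :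
    ∑ a, ∑ m ∈ Finset.range (Fintype.card Q), (if (m + 1) • a = b then h a else 0) = 0 := by
  have hN : (Fintype.card Q : ℂ) ≠ 0 := by exact_mod_cast Fintype.card_ne_zero
  have h1 : ∑ χ : AddChar Q ℂ, χ (-b) * ∑ a, (h a : ℂ) *
      ((Fintype.card Q : ℂ) * (if χ a = 1 then 1 else 0)) = 0 := by
    refine Finset.sum_eq_zero fun χ _ => ?_
    have h2 : ∑ a, (h a : ℂ) * (if χ a = 1 then 1 else 0) = 0 := by
      have := congrArg (fun x : ℝ => (x : ℂ)) (ker_sum_zero hodd h hev hE χ)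
      simp only [Complex.ofReal_sum, Complex.ofReal_zero] at this
      refine Eq.trans (Finset.sum_congr rfl fun a _ => ?_) this
      split_ifs <;> simp
    have h3 : ∀ a, (h a : ℂ) * ((Fintype.card Q : ℂ) * (if χ a = 1 then 1 else 0)) =
      (Fintype.card Q : ℂ) * ((h a : ℂ) * (if χ a = 1 then 1 else 0)) := fun a => by ring
    simp only [h3]
    rw [← Finset.mul_sum, h2, mul_zero, mul_zero]
  simp only [← ker_indicator, Finset.mul_sum] at h1
  have h4 : ∑ χ : AddChar Q ℂ, ∑ a, ∑ m ∈ Finset.range (Fintype.card Q),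
      χ (-b) * ((h a : ℂ) * χ ((m + 1) • a)) =
      (Fintype.card Q : ℂ) * ∑ a, ∑ m ∈ Finset.range (Fintype.card Q),
        (if (m + 1) • a = b then (h a : ℂ) else 0) := by
    rw [Finset.sum_comm, Finset.mul_sum]
    refine Finset.sum_congr rfl fun a _ => ?_
    rw [Finset.sum_comm, Finset.mul_sum]
    refine Finset.sum_congr rfl fun m _ => ?_
    have h5 : ∀ χ : AddChar Q ℂ, χ (-b) * ((h a : ℂ) * χ ((m + 1) • a)) =
        χ ((m + 1) • a - b) * (h a : ℂ) := by
      intro χ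
      rw [sub_eq_add_neg, AddChar.map_add_eq_mul]
      ring
    simp only [h5]
    rw [← Finset.sum_mul, AddChar.sum_apply_eq_ite]
    simp only [sub_eq_zero]
    split_ifs <;> ring
  rw [h4, mul_eq_zero] at h1
  have h6 := h1.resolve_left hN
  have h7 : ((∑ a, ∑ m ∈ Finset.range (Fintype.card Q),
      (if (m + 1) • a = b then h a else 0) : ℝ) : ℂ) = 0 := by
    rw [← h6]
    push_cast
    refine Finset.sum_congr rfl fun a _ => Finset.sum_congr rfl fun m _ => ?_
    split_ifs <;> simp
  exact_mod_cast h7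

/-- `Q2`. -/
lemma h_eq_zero (hodd : Odd (Fintype.card Q)) (h : Q → ℝ) (hev : ∀ a, h (-a) = h a)
    (hE : ∀ χ : AddChar Q ℂ, ∑ a, h a * Real.log ‖1 + χ a‖ = 0)
    (hO : ∀ a, h a ≠ 0 → OFS (addOrderOf a)) (a : Q) : h a = 0 := by
  by_contra ha
  obtain ⟨b, hb, hmax⟩ := Finset.exists_max_image (Finset.univ.filter fun a => h a ≠ 0)
    addOrderOf ⟨a, by simpa using ha⟩
  simp only [Finset.mem_filter, Finset.mem_univ, true_and] at hb hmax
  have h1 := mult_sum_zero hodd h hev hE b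
  have hterm : ∀ a, ∀ m : ℕ, (m + 1) • a = b → h a ≠ 0 → h a = h b := by
    intro a m hab ha
    have h2 : addOrderOf b ∣ addOrderOf a := hab ▸ addOrderOf_smul_dvd (m + 1)
    have h3 : addOrderOf ((m + 1) • a) = addOrderOf a := by
      rw [hab]
      exact le_antisymm (Nat.le_of_dvd (addOrderOf_pos a) h2) (hmax a ha)
    obtain ⟨j, hj⟩ := OFS_smul (m + 1) a (hO a ha) (coprime_of_addOrderOf _ a h3 (addOrderOf_pos a))
    rw [hab] at hj
    rcases hj with hj | hj
    · rw [hj, h_two_pow h (h_dbl hodd h hev hE)]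
    · rw [hj, hev, h_two_pow h (h_dbl hodd h hev hE)]
  have h4 : ∑ a, ∑ m ∈ Finset.range (Fintype.card Q),
      h b * (if (m + 1) • a = b then h a else 0) = 0 := by
    simp only [← Finset.mul_sum, h1, mul_zero]
  have hnn : ∀ a, ∀ m : ℕ, 0 ≤ h b * (if (m + 1) • a = b then h a else 0) := by
    intro a m
    split_ifs with hab
    · by_cases ha : h a = 0
      · rw [ha, mul_zero]
      · rw [hterm a m hab ha]; exact mul_self_nonneg _
    · rw [mul_zero]
  rw [Finset.sum_eq_zero_iff_of_nonneg
    (fun a _ => Finset.sum_nonneg fun m _ => hnn a m)] at h4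
  have h5 := h4 b (Finset.mem_univ _)
  rw [Finset.sum_eq_zero_iff_of_nonneg (fun m _ => hnn b m)] at h5
  have h6 := h5 0 (Finset.mem_range.2 Fintype.card_pos)
  simp at h6
  exact hb h6

end FiniteEnd

section General

lemma OFS_dvd {n d : ℕ} (hn : OFS n) (hd : d ∣ n) : OFS d := by
  obtain ⟨ho, h1, h⟩ := hn
  have : NeZero n := ⟨by omega⟩
  have hd0 : d ≠ 0 := by
    rintro rfl
    have := zero_dvd_iff.1 hd
    omega
  have : NeZero d := ⟨hd0⟩
  refine ⟨ho.of_dvd_nat hd, Nat.one_le_iff_ne_zero.2 hd0, ?_⟩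
  intro x hx
  have hu : IsUnit (x : ZMod d) := (ZMod.coe_int_isUnit_iff_isCoprime x d).2 hx.symm
  obtain ⟨v, hv⟩ := hu
  obtain ⟨u, hu⟩ := ZMod.unitsMap_surjective hd v
  have h2 : (((u : ZMod n).val : ℤ) : ZMod d) = (x : ZMod d) := by
    rw [← hv, ← hu, ZMod.unitsMap_val]
    push_cast
    rw [ZMod.natCast_val]
  have h3 : (d : ℤ) ∣ x - ((u : ZMod n).val : ℤ) := (ZMod.intCast_eq_intCast_iff_dvd_sub _ _ _).1 h2
  obtain ⟨j, hj⟩ := h ((u : ZMod n).val : ℤ)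
    (Nat.isCoprime_iff_coprime.2 (ZMod.val_coe_unit_coprime u))
  refine ⟨j, ?_⟩
  have hd' : (d : ℤ) ∣ n := by exact_mod_cast hd
  rcases hj with hj | hj
  · left
    have := dvd_add h3 (hd'.trans hj)
    rwa [sub_add_sub_cancel] at this
  · right
    have := dvd_add h3 (hd'.trans hj)
    rwa [← add_assoc, sub_add_cancel] at this

lemma exists_sep {G : Type*} [AddCommGroup G] [AddGroup.FG G] (h2 : ∀ g : G, 2 • g = 0 → g = 0)
    (D : Finset G) : ∃ (Q : Type) (_ : AddCommGroup Q) (_ : Fintype Q) (f : G →+ Q),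
      Odd (Fintype.card Q) ∧ ∀ d ∈ D, f d = 0 → d = 0 := by
  classical
  obtain ⟨r, ι, hι, p, hp, k, ⟨e⟩⟩ := AddCommGroup.equiv_free_prod_directSum_zmod G
  let q : ι → ℕ := fun i => p i ^ k i
  have hq0 : ∀ i, NeZero (q i) := fun i => ⟨pow_ne_zero _ (hp i).ne_zero⟩
  have hqodd : ∀ i, Odd (q i) := by
    intro i
    by_contra hev
    rw [Nat.not_odd_iff_even] at hev
    obtain ⟨c, hc⟩ := hev
    have hc0 : 0 < c := by
      have := (hq0 i).pos
      omega
    have h3 := h2 (e.symm (0, DirectSum.of (fun i => ZMod (q i)) i (c : ZMod (q i)))) (by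
      rw [← map_nsmul]
      have : (2 • ((0, DirectSum.of (fun i => ZMod (q i)) i (c : ZMod (q i))) :
          (Fin r →₀ ℤ) × DirectSum ι (fun i => ZMod (q i)))) = 0 := by
        rw [Prod.smul_mk, smul_zero, ← map_nsmul]
        have h4 : (2 • (c : ZMod (q i))) = 0 := by
          rw [two_nsmul, ← Nat.cast_add, ← hc, ZMod.natCast_self]
        rw [h4, map_zero]
        rfl
      exact (congrArg e.symm this).trans (map_zero _))
    rw [EmbeddingLike.map_eq_zero_iff, Prod.mk_eq_zero] at h3
    have h5 := DirectSum.of_injective (β := fun i => ZMod (q i)) i (h3.2.trans (map_zero _).symm)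
    rw [ZMod.natCast_eq_zero_iff] at h5
    have := Nat.le_of_dvd hc0 h5
    omega
  let M : ℕ := 2 * (∑ d ∈ D, ∑ i, ((e d).1 i).natAbs) + 1
  have hM : NeZero M := ⟨by omega⟩
  let f1 : (Fin r →₀ ℤ) →+ (Fin r → ZMod M) :=
    { toFun := fun x i => ((x i : ℤ) : ZMod M)
      map_zero' := by ext; simp
      map_add' := by intro x y; ext; simp }
  let f2 : (DirectSum ι (fun i => ZMod (q i))) →+ (∀ i, ZMod (q i)) :=
    { toFun := fun x i => x i
      map_zero' := by ext; simp
      map_add' := by intro x y; ext; simp }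
  refine ⟨(Fin r → ZMod M) × (∀ i, ZMod (q i)), inferInstance, inferInstance,
    (AddMonoidHom.prodMap f1 f2).comp e.toAddMonoidHom, ?_, ?_⟩
  · rw [Fintype.card_prod, Fintype.card_pi, Fintype.card_pi]
    simp only [ZMod.card]
    refine Odd.mul ?_ ?_
    · rw [Finset.prod_const]
      exact Odd.pow ⟨_, rfl⟩
    · exact Finset.prod_induction _ Odd (fun _ _ => Odd.mul) odd_one fun i _ => hqodd i
  · intro d hd hfd
    have hfd' : (f1 (e d).1, f2 (e d).2) = 0 := hfd
    rw [Prod.mk_eq_zero] at hfd'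
    obtain ⟨ha, hb⟩ := hfd'
    have h1 : (e d).1 = 0 := by
      ext i
      have h3 : (((e d).1 i : ℤ) : ZMod M) = 0 := congrFun ha i
      rw [ZMod.intCast_zmod_eq_zero_iff_dvd] at h3
      have h4 : ((e d).1 i).natAbs ≤ ∑ d ∈ D, ∑ i, ((e d).1 i).natAbs :=
        (Finset.single_le_sum (f := fun i => ((e d).1 i).natAbs) (fun _ _ => Nat.zero_le _)
          (Finset.mem_univ i)).trans
        (Finset.single_le_sum (f := fun d => ∑ i, ((e d).1 i).natAbs) (fun _ _ => Nat.zero_le _) hd)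
      exact Int.eq_zero_of_dvd_of_natAbs_lt_natAbs h3 (by rw [Int.natAbs_natCast]; omega)
    have h3 : (e d).2 = 0 := by
      refine DFinsupp.ext fun i => ?_
      exact congrFun hb i
    have h4 : e d = 0 := Prod.ext h1 h3
    exact (EmbeddingLike.map_eq_zero_iff (f := e)).1 h4

lemma count_map_injOn {G H : Type*} [DecidableEq G] [DecidableEq H] (f : G → H) (U : Finset G)
    (hf : Set.InjOn f U) (A : Multiset G) (hA : ∀ a ∈ A, a ∈ U) (x : G) (hx : x ∈ U) :
    (A.map f).count (f x) = A.count x := by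
  by_cases hxA : x ∈ A
  · exact Multiset.count_map_eq_count f A (fun a ha b hb => hf (hA a ha) (hA b hb)) x hxA
  · rw [Multiset.count_eq_zero_of_notMem hxA, Multiset.count_eq_zero]
    intro h
    obtain ⟨y, hy, hyx⟩ := Multiset.mem_map.1 h
    exact hxA (hf (hA y hy) hx hyx ▸ hy)

lemma mem_of_symc {G : Type*} [AddCommGroup G] [DecidableEq G] (A A' : Multiset G) (b : G)
    (h : symc A A' b ≠ 0) : b ∈ A + A' ∨ -b ∈ A + A' := by
  by_contra hc
  rw [not_or, Multiset.mem_add, Multiset.mem_add, not_or, not_or] at hc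
  apply h
  rw [symc, Multiset.count_eq_zero_of_notMem hc.1.1, Multiset.count_eq_zero_of_notMem hc.1.2,
    Multiset.count_eq_zero_of_notMem hc.2.1, Multiset.count_eq_zero_of_notMem hc.2.2]
  simp

lemma symc_zero_fg {G : Type*} [AddCommGroup G] [DecidableEq G] [AddGroup.FG G]
    (hO : ∀ g : G, IsOfFinAddOrder g → OFS (addOrderOf g)) (h2 : ∀ g : G, 2 • g = 0 → g = 0)
    (A A' : Multiset G) (hFS : FS A = FS A') (b : G) : symc A A' b = 0 := by
  classical
  set T : Finset G := (A + A').toFinset ∪ (A + A').toFinset.image (fun x => -x) with hT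
  have hTneg : ∀ x ∈ T, -x ∈ T := by
    intro x hx
    rw [hT, Finset.mem_union, Finset.mem_image] at hx ⊢
    rcases hx with hx | ⟨y, hy, rfl⟩
    · exact Or.inr ⟨x, hx, rfl⟩
    · left; rwa [neg_neg]
  have hTA : ∀ x ∈ A, x ∈ T := fun x hx => Finset.mem_union_left _ (by simp [hx])
  have hTA' : ∀ x ∈ A', x ∈ T := fun x hx => Finset.mem_union_left _ (by simp [hx])
  have hTsymc : ∀ x, symc A A' x ≠ 0 → x ∈ T := by
    intro x hx
    rcases mem_of_symc A A' x hx with h | h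
    · exact Finset.mem_union_left _ (Multiset.mem_toFinset.2 h)
    · exact neg_neg x ▸ hTneg _ (Finset.mem_union_left _ (Multiset.mem_toFinset.2 h))
  set U : Finset G := T ∪ T.image (fun x => 2 • x) with hU
  have hTU : ∀ x ∈ T, x ∈ U := fun x hx => Finset.mem_union_left _ hx
  have hTU2 : ∀ x ∈ T, 2 • x ∈ U := fun x hx =>
    Finset.mem_union_right _ (Finset.mem_image_of_mem _ hx)
  have hUneg : ∀ x ∈ U, -x ∈ U := by
    intro x hx
    rw [hU, Finset.mem_union, Finset.mem_image] at hx
    rcases hx with hx | ⟨y, hy, rfl⟩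
    · exact hTU _ (hTneg x hx)
    · rw [← smul_neg]; exact hTU2 _ (hTneg y hy)
  obtain ⟨Q, _, _, f, hodd, hsep⟩ := exists_sep h2 ((U ×ˢ U).image fun z => z.1 - z.2)
  have hinj : Set.InjOn f U := by
    intro x hx y hy hxy
    rw [← sub_eq_zero]
    refine hsep _ (Finset.mem_image.2 ⟨(x, y), Finset.mem_product.2 ⟨hx, hy⟩, rfl⟩) ?_
    rw [map_sub, hxy, sub_self]
  have hmap : ∀ x ∈ U, symc (A.map f) (A'.map f) (f x) = symc A A' x := by
    intro x hx
    rw [symc, symc, ← map_neg, count_map_injOn f U hinj A (fun a ha => hTU a (hTA a ha)) x hx,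
      count_map_injOn f U hinj A' (fun a ha => hTU a (hTA' a ha)) x hx,
      count_map_injOn f U hinj A (fun a ha => hTU a (hTA a ha)) _ (hUneg x hx),
      count_map_injOn f U hinj A' (fun a ha => hTU a (hTA' a ha)) _ (hUneg x hx)]
  have hE := symc_sum hodd (A.map f) (A'.map f) (by rw [FS_map, FS_map, hFS])
  have hev := symc_neg (A.map f) (A'.map f)
  have hdbl : ∀ x ∈ T, symc A A' (2 • x) = symc A A' x := by
    intro x hx
    rw [← hmap _ (hTU2 x hx), ← hmap _ (hTU x hx), map_nsmul, h_dbl hodd _ hev hE]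
  have hpow : ∀ x, symc A A' x ≠ 0 → ∀ j : ℕ, symc A A' (2 ^ j • x) = symc A A' x := by
    intro x hx j
    induction j with
    | zero => simp
    | succ j ih => rw [pow_succ', mul_nsmul', hdbl _ (hTsymc _ (by rw [ih]; exact hx)), ih]
  have hfin : ∀ x, symc A A' x ≠ 0 → IsOfFinAddOrder x := by
    intro x hx
    have hni : ¬ Function.Injective (fun j : ℕ => (⟨2 ^ j • x,
        hTsymc _ (by rw [hpow x hx j]; exact hx)⟩ : T)) := not_injective_infinite_finite _
    rw [Function.Injective] at hni
    push Not at hni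
    obtain ⟨i, j, hij, hne⟩ := hni
    have hij' : 2 ^ i • x = 2 ^ j • x := congrArg Subtype.val hij
    by_contra hx'
    have := (injective_nsmul_iff_not_isOfFinAddOrder.2 hx') hij'
    exact hne (Nat.pow_right_injective le_rfl this)
  have hOQ : ∀ y, symc (A.map f) (A'.map f) y ≠ 0 → OFS (addOrderOf y) := by
    intro y hy
    have hyT : ∃ x ∈ T, f x = y := by
      rcases mem_of_symc _ _ y hy with h | h
      · rw [← Multiset.map_add, Multiset.mem_map] at h
        obtain ⟨x, hx, hxy⟩ := h
        exact ⟨x, Finset.mem_union_left _ (Multiset.mem_toFinset.2 hx), hxy⟩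
      · rw [← Multiset.map_add, Multiset.mem_map] at h
        obtain ⟨x, hx, hxy⟩ := h
        exact ⟨-x, hTneg _ (Finset.mem_union_left _ (Multiset.mem_toFinset.2 hx)), by
          rw [map_neg, hxy, neg_neg]⟩
    obtain ⟨x, hx, rfl⟩ := hyT
    rw [hmap x (hTU x hx)] at hy
    exact OFS_dvd (hO x (hfin x hy)) (addOrderOf_map_dvd f x)
  by_contra hb
  have := h_eq_zero hodd _ hev hE hOQ (f b)
  rw [hmap b (hTU b (hTsymc b hb))] at this
  exact hb this

lemma OFS_no_two {G : Type*} [AddCommGroup G]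
    (hO : ∀ g : G, IsOfFinAddOrder g → OFS (addOrderOf g)) (g : G) (hg : 2 • g = 0) : g = 0 := by
  have h1 := hO g (isOfFinAddOrder_iff_nsmul_eq_zero.2 ⟨2, by norm_num, hg⟩)
  have h2 : addOrderOf g ∣ 2 := addOrderOf_dvd_of_nsmul_eq_zero hg
  rcases (Nat.dvd_prime Nat.prime_two).1 h2 with h | h
  · exact AddMonoid.addOrderOf_eq_one_iff.1 h
  · have := h1.1
    rw [h] at this
    exact absurd this (by decide)

lemma Sim0_fg {G : Type*} [AddCommGroup G] [DecidableEq G] [AddGroup.FG G]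
    (hO : ∀ g : G, IsOfFinAddOrder g → OFS (addOrderOf g))
    (A A' : Multiset G) (hFS : FS A = FS A') : Sim0 A A' := by
  refine Sim0_of_sym (OFS_no_two hO) hFS fun a => ?_
  have := symc_zero_fg hO (OFS_no_two hO) A A' hFS a
  rw [symc, sub_eq_zero] at this
  exact_mod_cast this

lemma Sim0_map {G H : Type*} [AddCommGroup G] [AddCommGroup H] [DecidableEq G] [DecidableEq H]
    (f : G →+ H) (A A' : Multiset G) (h : Sim0 A A') : Sim0 (A.map f) (A'.map f) := by
  obtain ⟨B, hB, hs, rfl⟩ := h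
  obtain ⟨C, rfl⟩ := Multiset.le_iff_exists_add.1 hB
  refine ⟨B.map f, ?_, ?_, ?_⟩
  · rw [Multiset.map_add]; exact Multiset.le_add_right _ _
  · rw [← map_multiset_sum, hs, map_zero]
  · rw [add_tsub_cancel_left, Multiset.map_add, Multiset.map_add, add_tsub_cancel_left,
      Multiset.map_map, Multiset.map_map]
    congr 2
    funext x
    simp

lemma OFS_imp_Sim0 {G : Type*} [AddCommGroup G] [DecidableEq G]
    (hO : ∀ g : G, IsOfFinAddOrder g → OFS (addOrderOf g))
    (A A' : Multiset G) (hFS : FS A = FS A') : Sim0 A A' := by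
  let K : AddSubgroup G := AddSubgroup.closure ((A + A').toFinset : Set G)
  have hfg : AddGroup.FG K := (AddGroup.fg_iff_addSubgroup_fg K).2 ⟨(A + A').toFinset, rfl⟩
  have hlift : ∀ C : Multiset G, (∀ a ∈ C, a ∈ K) → ∃ B : Multiset K, B.map K.subtype = C := by
    intro C hC
    refine ⟨C.attach.map fun a => ⟨a.1, hC a.1 a.2⟩, ?_⟩
    rw [Multiset.map_map]
    exact Multiset.attach_map_val C
  obtain ⟨B, hB⟩ := hlift A fun a ha => AddSubgroup.subset_closure (by simp [ha])
  obtain ⟨B', hB'⟩ := hlift A' fun a ha => AddSubgroup.subset_closure (by simp [ha])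
  have h1 : FS B = FS B' := by
    rw [← hB, ← hB', FS_map, FS_map] at hFS
    exact Multiset.map_injective K.subtype_injective hFS
  rw [← hB, ← hB']
  refine Sim0_map _ _ _ (Sim0_fg ?_ B B' h1)
  intro g hg
  have h2 := hO (g : G) (by
    rw [← addOrderOf_pos_iff, AddSubgroup.addOrderOf_coe, addOrderOf_pos_iff]; exact hg)
  rwa [AddSubgroup.addOrderOf_coe] at h2

end General


/-- Characterization of `FS`-regular abelian groups. -/
theorem FSRegular_iff_orders_OFS (G : Type*) [AddCommGroup G] [DecidableEq G] :
    FSRegular G ↔ ∀ g : G, IsOfFinAddOrder g → OFS (addOrderOf g) := by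
  constructor
  · intro hG g hg
    exact regular_imp_OFS hG g hg
  · intro hO A A'
    exact ⟨OFS_imp_Sim0 hO A A', FS_eq_of_Sim0⟩
end

section
/- Let n, d ≥ 1 be positive integers and let f : (ℤ/nℤ)^d → ℂ. Then for every x ∈ (ℤ/nℤ)^d, f(x) = (1/(n^{d−1}·φ(n))) · ∑_{ψ ∈ Hom((ℤ/nℤ)^d, ℤ/nℤ)} Rf(ψ, ψ(x)) · ∏_{p prime, p ∣ n, ψ takes values in p(ℤ/nℤ)} (1 − p^{d−1}), where φ is Euler's totient function. -/
open scoped Classical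

noncomputable instance (n d : ℕ) [NeZero n] : Fintype ((Fin d → ZMod n) →+ ZMod n) :=
  Fintype.ofInjective (fun ψ => (ψ : (Fin d → ZMod n) → ZMod n)) DFunLike.coe_injective

/-- The discrete Radon transform of `f : (ℤ/nℤ)^d → ℂ`:
`Rf(ψ, c) = ∑_{x : ψ(x) = c} f(x)`. -/
noncomputable def Radon (n d : ℕ) [NeZero n] (f : (Fin d → ZMod n) → ℂ)
    (ψ : (Fin d → ZMod n) →+ ZMod n) (c : ZMod n) : ℂ :=
  ∑ x ∈ Finset.univ.filter (fun x => ψ x = c), f x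

open Finset in
lemma radon_card_tors (n m : ℕ) [NeZero n] (hm : m ∣ n) :
    (univ.filter (fun c : ZMod n => m • c = 0)).card = m := by
  have h := IsAddCyclic.card_nsmulAddMonoidHom_ker (G := ZMod n) m
  rw [Nat.card_zmod, Nat.gcd_eq_right hm] at h
  rw [Nat.card_eq_fintype_card, Fintype.card_subtype] at h
  refine Eq.trans (congrArg Finset.card ?_) h
  ext c
  simp [AddMonoidHom.mem_ker]

open Finset in
lemma radon_card_tors_pi (n m d : ℕ) [NeZero n] (hm : m ∣ n) :
    (univ.filter (fun c : Fin d → ZMod n => m • c = 0)).card = m ^ d := by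
  have h := Fintype.card_piFinset_const (univ.filter (fun c : ZMod n => m • c = 0)) d
  rw [radon_card_tors n m hm] at h
  rw [← h]
  congr 1
  ext c
  simp [funext_iff]

open Finset in
/-- The number of vectors orthogonal to `z`. -/
lemma radon_card_orth (n d : ℕ) [NeZero n] (z : Fin d → ZMod n) :
    (univ.filter (fun a : Fin d → ZMod n => a ⬝ᵥ z = 0)).card * addOrderOf z = n ^ d := by
  let E : (Fin d → ZMod n) →+ ZMod n :=
    { toFun := fun a => a ⬝ᵥ z, map_zero' := by simp, map_add' := fun a b => by simp }
  have hE : ∀ a, E a = a ⬝ᵥ z := fun a => rfl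
  have h := AddSubgroup.card_mul_index E.ker
  rw [AddSubgroup.index_ker] at h
  obtain ⟨g, hg⟩ := (AddSubgroup.isAddCyclic_iff_exists_zmultiples_eq_top E.range).1 inferInstance
  have h1 : Nat.card E.range = addOrderOf z := by
    rw [← hg, Nat.card_zmultiples, addOrderOf_eq_addOrderOf_iff]
    intro k
    constructor
    · intro hk
      ext i
      have : z i ∈ AddSubgroup.zmultiples g := by
        rw [hg]
        exact ⟨Pi.single i 1, by simp [hE]⟩
      obtain ⟨l, hl⟩ := this
      simp only at hl
      rw [Pi.smul_apply, ← hl, smul_comm, hk]; simp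
    · intro hk
      have : g ∈ E.range := by rw [← hg]; exact AddSubgroup.mem_zmultiples g
      obtain ⟨a, rfl⟩ := this
      rw [hE, ← dotProduct_smul, hk]; simp
  rw [h1] at h
  have h2 : Nat.card E.ker = (univ.filter (fun a : Fin d → ZMod n => a ⬝ᵥ z = 0)).card := by
    rw [Nat.card_eq_fintype_card, Fintype.card_subtype]
    congr 1
    ext a
    simp [AddMonoidHom.mem_ker, hE]
  rw [← h2, h]
  simp

open Finset in
lemma radon_card_dvd (n d m : ℕ) [NeZero n] (hm : m ∣ n) (z : Fin d → ZMod n) :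
    (univ.filter (fun a : Fin d → ZMod n => (∀ i, (m : ZMod n) ∣ a i) ∧ a ⬝ᵥ z = 0)).card * m ^ d
      = (univ.filter (fun a : Fin d → ZMod n => a ⬝ᵥ (m • z) = 0)).card := by
  rw [Finset.card_eq_sum_card_fiberwise (f := fun a => m • a)
    (s := univ.filter (fun a : Fin d → ZMod n => a ⬝ᵥ (m • z) = 0))
    (t := univ.filter (fun a : Fin d → ZMod n => (∀ i, (m : ZMod n) ∣ a i) ∧ a ⬝ᵥ z = 0))]
  · rw [Finset.sum_const_nat (m := m ^ d)]
    intro b hb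
    simp only [mem_filter, mem_univ, true_and] at hb
    obtain ⟨hb1, hb2⟩ := hb
    choose a ha using hb1
    have hab : m • a = b := by ext i; simp [ha]
    rw [← radon_card_tors_pi n m d hm]
    apply Finset.card_nbij' (fun c => c - a) (fun c => c + a)
    · intro c hc
      simp only [coe_filter, mem_filter, mem_univ, true_and, Set.mem_ofPred_eq] at hc ⊢
      rw [smul_sub, hc.2, hab, sub_self]
    · intro c hc
      simp only [coe_filter, mem_filter, mem_univ, true_and, Set.mem_ofPred_eq] at hc ⊢
      have : m • (c + a) = b := by rw [smul_add, hc, hab, zero_add]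
      refine ⟨?_, this⟩
      rw [dotProduct_smul, ← smul_dotProduct, this, hb2]
    · intro c _; simp
    · intro c _; simp
  · intro a ha
    simp only [coe_filter, mem_univ, true_and, Set.mem_ofPred_eq] at ha ⊢
    refine ⟨fun i => ⟨a i, by simp⟩, ?_⟩
    rw [smul_dotProduct, ← dotProduct_smul, ha]

lemma radon_dvd_iff (n m : ℕ) [NeZero n] (hm : m ∣ n) (c : ZMod n) :
    (m : ZMod n) ∣ c ↔ m ∣ c.val := by
  constructor
  · rintro ⟨b, rfl⟩
    have : ((m : ZMod n) * b) = ((m * b.val : ℕ) : ZMod n) := by simp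
    rw [this, ZMod.val_natCast]
    exact (Nat.dvd_mod_iff hm).2 (Dvd.intro _ rfl)
  · rintro ⟨k, hk⟩
    refine ⟨k, ?_⟩
    rw [← ZMod.natCast_zmod_val c, hk]; simp

lemma radon_prod_dvd (n : ℕ) [NeZero n] (S : Finset ℕ) (hS : S ⊆ n.primeFactors) :
    (∏ p ∈ S, p) ∣ n :=
  Finset.prod_primes_dvd n (fun p hp => (Nat.prime_of_mem_primeFactors (hS hp)).prime)
    (fun p hp => Nat.dvd_of_mem_primeFactors (hS hp))

lemma radon_prod_dvd_iff (n : ℕ) [NeZero n] (S : Finset ℕ) (hS : S ⊆ n.primeFactors) (c : ZMod n) :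
    ((∏ p ∈ S, p : ℕ) : ZMod n) ∣ c ↔ ∀ p ∈ S, (p : ZMod n) ∣ c := by
  rw [radon_dvd_iff n _ (radon_prod_dvd n S hS)]
  constructor
  · intro h p hp
    rw [radon_dvd_iff n _ (Nat.dvd_of_mem_primeFactors (hS hp))]
    exact (Finset.dvd_prod_of_mem (fun p => p) hp).trans h
  · intro h
    refine Finset.prod_primes_dvd _ (fun p hp => (Nat.prime_of_mem_primeFactors (hS hp)).prime) ?_
    intro p hp
    rw [← radon_dvd_iff n _ (Nat.dvd_of_mem_primeFactors (hS hp))]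
    exact h p hp

lemma radon_gcd_prod (N : ℕ) (S : Finset ℕ) (hS : ∀ p ∈ S, p.Prime) :
    N.gcd (∏ p ∈ S, p) = ∏ p ∈ S, N.gcd p := by
  induction S using Finset.induction_on with
  | empty => simp
  | insert q S hq ih =>
    rw [Finset.prod_insert hq, Finset.prod_insert hq, Nat.Coprime.gcd_mul,
      ih (fun p hp => hS p (Finset.mem_insert_of_mem hp))]
    apply Nat.Coprime.prod_right
    intro p hp
    rw [Nat.coprime_primes (hS q (Finset.mem_insert_self _ _)) (hS p (Finset.mem_insert_of_mem hp))]
    rintro rfl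
    exact hq hp

open Finset in
/-- Each term of the inclusion-exclusion expansion. -/
lemma radon_term (n d : ℕ) [NeZero n] (hd : 1 ≤ d) (z : Fin d → ZMod n)
    (S : Finset ℕ) (hS : S ⊆ n.primeFactors) :
    (∏ p ∈ S, (-(p : ℂ) ^ (d - 1))) *
      ((univ.filter (fun a : Fin d → ZMod n =>
        (∀ p ∈ S, ∀ i, (p : ZMod n) ∣ a i) ∧ a ⬝ᵥ z = 0)).card : ℂ)
      = (n : ℂ) ^ d / (addOrderOf z : ℂ) *
        ∏ p ∈ S, (-(((addOrderOf z).gcd p : ℕ) : ℂ) / (p : ℂ)) := by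
  set m := ∏ p ∈ S, p with hm
  have hmn : m ∣ n := radon_prod_dvd n S hS
  have hprime : ∀ p ∈ S, p.Prime := fun p hp => Nat.prime_of_mem_primeFactors (hS hp)
  have hm0 : m ≠ 0 := fun h => NeZero.ne n (by rw [h] at hmn; exact zero_dvd_iff.1 hmn)
  have hfil : (univ.filter (fun a : Fin d → ZMod n =>
        (∀ p ∈ S, ∀ i, (p : ZMod n) ∣ a i) ∧ a ⬝ᵥ z = 0)) =
      (univ.filter (fun a : Fin d → ZMod n => (∀ i, (m : ZMod n) ∣ a i) ∧ a ⬝ᵥ z = 0)) := by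
    ext a
    simp only [mem_filter, mem_univ, true_and, hm, radon_prod_dvd_iff n S hS]
    constructor
    · rintro ⟨h, h'⟩; exact ⟨fun i p hp => h p hp i, h'⟩
    · rintro ⟨h, h'⟩; exact ⟨fun p hp i => h i p hp, h'⟩
  rw [hfil]
  have h1 := radon_card_dvd n d m hmn z
  have h2 := radon_card_orth n d (m • z)
  rw [← h1, addOrderOf_nsmul' z hm0] at h2
  set C := (univ.filter (fun a : Fin d → ZMod n =>
    (∀ i, (m : ZMod n) ∣ a i) ∧ a ⬝ᵥ z = 0)).card with hC
  set N := addOrderOf z with hN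
  have hN0 : N ≠ 0 := (addOrderOf_pos z).ne'
  have h3 : C * m ^ d * N = n ^ d * N.gcd m := by
    rw [← h2, mul_assoc _ (N / N.gcd m), Nat.div_mul_cancel (Nat.gcd_dvd_left _ _)]
  have h3' : (C : ℂ) * (m : ℂ) ^ d * N = (n : ℂ) ^ d * (N.gcd m : ℕ) := by exact_mod_cast h3
  have hmC : (m : ℂ) ≠ 0 := by exact_mod_cast hm0
  have hNC : (N : ℂ) ≠ 0 := by exact_mod_cast hN0
  have hg : ((N.gcd m : ℕ) : ℂ) = ∏ p ∈ S, ((N.gcd p : ℕ) : ℂ) := by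
    rw [hm, radon_gcd_prod N S hprime]; push_cast; rfl
  have hmc : (m : ℂ) = ∏ p ∈ S, (p : ℂ) := by rw [hm]; push_cast; rfl
  have e1 : (∏ p ∈ S, (-(p : ℂ) ^ (d - 1))) = (-1) ^ S.card * (m : ℂ) ^ (d - 1) := by
    rw [Finset.prod_neg, hmc, Finset.prod_pow]
  have e2 : ∏ p ∈ S, (-((N.gcd p : ℕ) : ℂ) / (p : ℂ)) = (-1) ^ S.card * (N.gcd m : ℕ) / m := by
    rw [Finset.prod_div_distrib, Finset.prod_neg, hg, hmc]
  rw [e1, e2]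
  obtain ⟨e, rfl⟩ : ∃ e, d = e + 1 := ⟨d - 1, by omega⟩
  simp only [Nat.add_sub_cancel]
  field_simp
  rw [pow_succ (m : ℂ)] at h3'
  linear_combination h3'

open Finset in
lemma radon_kernel (n d : ℕ) [NeZero n] (hd : 1 ≤ d) (z : Fin d → ZMod n) :
    ∑ a ∈ univ.filter (fun a : Fin d → ZMod n => a ⬝ᵥ z = 0),
      ∏ p ∈ n.primeFactors, (if ∀ i, (p : ZMod n) ∣ a i then 1 - (p : ℂ) ^ (d - 1) else 1)
      = if z = 0 then (n : ℂ) ^ (d - 1) * (Nat.totient n : ℂ) else 0 := by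
  have step : ∀ a : Fin d → ZMod n,
      ∏ p ∈ n.primeFactors, (if ∀ i, (p : ZMod n) ∣ a i then 1 - (p : ℂ) ^ (d - 1) else 1)
      = ∑ S ∈ n.primeFactors.powerset, (∏ p ∈ S, (-(p : ℂ) ^ (d - 1))) *
        (if ∀ p ∈ S, ∀ i, (p : ZMod n) ∣ a i then 1 else 0) := by
    intro a
    have : ∀ p ∈ n.primeFactors,
        (if ∀ i, (p : ZMod n) ∣ a i then 1 - (p : ℂ) ^ (d - 1) else 1)
        = 1 + (-(p : ℂ) ^ (d - 1)) * (if ∀ i, (p : ZMod n) ∣ a i then 1 else 0) := by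
      intro p _; split_ifs <;> ring
    rw [Finset.prod_congr rfl this, Finset.prod_one_add]
    refine Finset.sum_congr rfl fun S _ => ?_
    rw [Finset.prod_mul_distrib, Finset.prod_ite_zero]
    simp
  simp_rw [step]
  rw [Finset.sum_comm]
  have step2 : ∀ S ∈ n.primeFactors.powerset,
      ∑ a ∈ univ.filter (fun a : Fin d → ZMod n => a ⬝ᵥ z = 0),
        (∏ p ∈ S, (-(p : ℂ) ^ (d - 1))) * (if ∀ p ∈ S, ∀ i, (p : ZMod n) ∣ a i then 1 else 0)
      = (n : ℂ) ^ d / (addOrderOf z : ℂ) *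
        ∏ p ∈ S, (-(((addOrderOf z).gcd p : ℕ) : ℂ) / (p : ℂ)) := by
    intro S hS
    rw [← radon_term n d hd z S (mem_powerset.1 hS), ← Finset.mul_sum, Finset.sum_boole,
      Finset.filter_filter]
    congr 4
    ext a
    exact and_comm
  rw [Finset.sum_congr rfl step2, ← Finset.mul_sum, ← Finset.prod_one_add]
  split_ifs with hz
  · subst hz
    have ht := congrArg (fun q : ℚ => (q : ℂ)) (Nat.totient_eq_mul_prod_factors n)
    simp only [Rat.cast_natCast, Rat.cast_mul, Rat.cast_prod, Rat.cast_sub, Rat.cast_one,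
      Rat.cast_inv] at ht
    rw [ht]
    obtain ⟨e, rfl⟩ : ∃ e, d = e + 1 := ⟨d - 1, by omega⟩
    simp only [addOrderOf_zero, Nat.gcd_one_left, Nat.cast_one, Nat.add_sub_cancel, div_one]
    rw [pow_succ, mul_assoc]
    congr 2
    refine Finset.prod_congr rfl fun p _ => ?_
    ring
  · have hN : addOrderOf z ≠ 1 := by simpa using hz
    obtain ⟨q, hq, hqN⟩ := Nat.exists_prime_and_dvd hN
    have hNn : addOrderOf z ∣ n := by
      rw [addOrderOf_dvd_iff_nsmul_eq_zero]
      ext i; simp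
    rw [Finset.prod_eq_zero (i := q), mul_zero]
    · exact Nat.mem_primeFactors.2 ⟨hq, hqN.trans hNn, NeZero.ne n⟩
    · rw [Nat.gcd_eq_right hqN]
      have : (q : ℂ) ≠ 0 := by exact_mod_cast hq.ne_zero
      field_simp
      ring

/-- Homomorphisms as vectors. -/
noncomputable def radonEquiv (n d : ℕ) [NeZero n] :
    (Fin d → ZMod n) ≃ ((Fin d → ZMod n) →+ ZMod n) where
  toFun a := { toFun := fun z => a ⬝ᵥ z, map_zero' := by simp, map_add' := fun b c => by simp [dotProduct_add] }
  invFun ψ i := ψ (Pi.single i 1)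
  left_inv a := by ext i; simp
  right_inv ψ := by
    refine DFunLike.ext _ _ fun z => ?_
    have : z = ∑ i, z i • (Pi.single i 1 : Fin d → ZMod n) := by
      simpa using pi_eq_sum_univ' z
    conv_rhs => rw [this, map_sum]
    simp only [ZMod.map_smul]
    simp [dotProduct, mul_comm]

lemma radonEquiv_apply (n d : ℕ) [NeZero n] (a z : Fin d → ZMod n) :
    radonEquiv n d a z = a ⬝ᵥ z := rfl

lemma radonEquiv_dvd (n d : ℕ) [NeZero n] (a : Fin d → ZMod n) (p : ℕ) :
    (∀ y : Fin d → ZMod n, ∃ z : ZMod n, radonEquiv n d a y = (p : ZMod n) * z) ↔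
      ∀ i, (p : ZMod n) ∣ a i := by
  constructor
  · intro h i
    have h' := h (Pi.single i 1)
    rw [radonEquiv_apply, dotProduct_single_one] at h'
    exact h'
  · intro h y
    change (p : ZMod n) ∣ ∑ i, a i * y i
    exact Finset.dvd_sum fun i _ => (h i).mul_right _

/-- Inversion formula for the discrete Radon transform on `(ℤ/nℤ)^d`. -/
theorem radon_inversion (n d : ℕ) [NeZero n] (hd : 1 ≤ d)
    (f : (Fin d → ZMod n) → ℂ) (x : Fin d → ZMod n) :
    f x = (1 / ((n : ℂ) ^ (d - 1) * (Nat.totient n : ℂ))) *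
      ∑ ψ : (Fin d → ZMod n) →+ ZMod n,
        Radon n d f ψ (ψ x) *
          ∏ p ∈ n.primeFactors,
            (if ∀ y : Fin d → ZMod n, ∃ z : ZMod n, ψ y = (p : ZMod n) * z
              then 1 - (p : ℂ) ^ (d - 1) else 1) := by
  rw [← (radonEquiv n d).sum_comp]
  have term : ∀ a : Fin d → ZMod n,
      Radon n d f (radonEquiv n d a) (radonEquiv n d a x) *
        ∏ p ∈ n.primeFactors,
          (if ∀ y : Fin d → ZMod n, ∃ z : ZMod n, radonEquiv n d a y = (p : ZMod n) * z
            then 1 - (p : ℂ) ^ (d - 1) else 1)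
      = ∑ y : Fin d → ZMod n, if a ⬝ᵥ y = a ⬝ᵥ x then
        f y * ∏ p ∈ n.primeFactors,
          (if ∀ i, (p : ZMod n) ∣ a i then 1 - (p : ℂ) ^ (d - 1) else 1) else 0 := by
    intro a
    rw [Radon, Finset.sum_mul, Finset.sum_filter]
    refine Finset.sum_congr rfl fun y _ => ?_
    refine if_congr Iff.rfl ?_ rfl
    congr 1
    exact Finset.prod_congr rfl fun p _ => if_congr (radonEquiv_dvd n d a p) rfl rfl
  rw [Finset.sum_congr rfl fun a _ => term a, Finset.sum_comm]
  have key : ∀ y : Fin d → ZMod n,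
      (∑ a : Fin d → ZMod n, if a ⬝ᵥ y = a ⬝ᵥ x then
        f y * ∏ p ∈ n.primeFactors,
          (if ∀ i, (p : ZMod n) ∣ a i then 1 - (p : ℂ) ^ (d - 1) else 1) else 0)
      = if y = x then f y * ((n : ℂ) ^ (d - 1) * (Nat.totient n : ℂ)) else 0 := by
    intro y
    have h := radon_kernel n d hd (y - x)
    simp only [dotProduct_sub, sub_eq_zero] at h
    rw [← Finset.sum_filter, ← Finset.mul_sum, h]
    split_ifs <;> simp
  have hn : (n : ℂ) ≠ 0 := by exact_mod_cast NeZero.ne n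
  have ht : (Nat.totient n : ℂ) ≠ 0 := by
    exact_mod_cast (Nat.totient_pos.2 (NeZero.pos n)).ne'
  rw [Finset.sum_congr rfl fun y _ => key y]
  simp only [Finset.sum_ite_eq', Finset.mem_univ, if_true]
  field_simp
end

section
/- For any n ∈ O_FS and any positive integer d ≥ 1, the group (ℤ/nℤ)^d is FS-regular: for any two finite multisets A, A' with elements in (ℤ/nℤ)^d, FS(A) = FS(A') if and only if A ∼₀ A'. -/
open Filter Topology

/-- weights -/
noncomputable def hh (s : ℝ) (i : ℕ) : ℝ := ((i : ℝ) + 1) ^ (-s)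

lemma hh_zero (s : ℝ) : hh s 0 = 1 := by simp [hh]

lemma hh_bound (s : ℝ) (h1 : 1 ≤ s) (h2 : s ≤ 2) (i : ℕ) :
    |hh s (i + 1) - hh s i| ≤ 2 / ((i : ℝ) + 1) ^ 2 := by
  unfold hh
  push_cast
  set x : ℝ := (i : ℝ) + 1 with hx
  have hx1 : 1 ≤ x := by rw [hx]; have := Nat.cast_nonneg (α := ℝ) i; linarith
  have hx0 : 0 < x := by linarith
  have hy0 : 0 < x + 1 := by linarith
  have hle : (x + 1) ^ (-s) ≤ x ^ (-s) :=
    Real.rpow_le_rpow_of_nonpos hx0 (by linarith) (by linarith)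
  rw [abs_sub_comm, abs_of_nonneg (by linarith)]
  have e1 : (x + 1) ^ (-s) = x ^ (-s) * (x / (x + 1)) ^ s := by
    rw [Real.div_rpow hx0.le hy0.le, Real.rpow_neg hx0.le, Real.rpow_neg hy0.le]
    have := (Real.rpow_pos_of_pos hx0 s).ne'
    field_simp
  have e2 : (x / (x + 1)) ^ (2 : ℝ) ≤ (x / (x + 1)) ^ s :=
    Real.rpow_le_rpow_of_exponent_ge (by positivity) ((div_le_one hy0).2 (by linarith)) h2
  have e3 : x ^ (-s) ≤ x⁻¹ := by
    rw [← Real.rpow_neg_one]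
    exact Real.rpow_le_rpow_of_exponent_le hx1 (by linarith)
  have e4 : (x / (x + 1)) ^ s ≤ 1 :=
    Real.rpow_le_one (by positivity) ((div_le_one hy0).2 (by linarith)) (by linarith)
  rw [Real.rpow_two] at e2
  calc x ^ (-s) - (x + 1) ^ (-s) = x ^ (-s) * (1 - (x / (x + 1)) ^ s) := by rw [e1]; ring
    _ ≤ x⁻¹ * (1 - (x / (x + 1)) ^ 2) := by
        apply mul_le_mul e3 (by linarith) (by linarith) (by positivity)
    _ ≤ 2 / x ^ 2 := by
        rw [div_pow, inv_mul_le_iff₀ hx0]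
        have : 1 - x ^ 2 / (x + 1) ^ 2 = (2 * x + 1) / (x + 1) ^ 2 := by field_simp; ring
        rw [this, ← mul_div_assoc, div_le_div_iff₀ (by positivity) (by positivity)]
        nlinarith [mul_pos hx0 hx0, mul_pos (mul_pos hx0 hx0) hx0]

lemma hh_tendsto (s : ℝ) (h1 : 1 ≤ s) : Tendsto (hh s) atTop (𝓝 0) := by
  have := (tendsto_rpow_neg_atTop (y := s) (by linarith)).comp
    (tendsto_natCast_atTop_atTop (R := ℝ) |>.comp (tendsto_add_atTop_nat 1))
  refine this.congr fun i => ?_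
  simp [hh]

lemma by_parts (w : ℂ) (s : ℝ) (M : ℕ) :
    (1 - w) * ∑ i ∈ Finset.range (M + 1), w ^ (i + 1) * (hh s i : ℂ) =
      w - w ^ (M + 2) * hh s M +
        ∑ i ∈ Finset.range M, w ^ (i + 2) * ((hh s (i + 1) : ℂ) - hh s i) := by
  induction M with
  | zero => simp [hh_zero]; ring
  | succ M ih =>
    rw [Finset.sum_range_succ, mul_add, ih, Finset.sum_range_succ _ M]
    ring

/-- remainder -/
noncomputable def RR (w : ℂ) (s : ℝ) : ℂ := ∑' i : ℕ, w ^ (i + 2) * ((hh s (i + 1) : ℂ) - hh s i)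

lemma summable_bd : Summable fun i : ℕ => 2 / ((i : ℝ) + 1) ^ 2 := by
  have := (summable_nat_add_iff 1).2 (Real.summable_one_div_nat_pow.2 (one_lt_two))
  refine (this.mul_left 2).congr fun i => ?_
  push_cast; ring

lemma term_bd (w : ℂ) (hw : ‖w‖ = 1) (s : ℝ) (h1 : 1 ≤ s) (h2 : s ≤ 2) (i : ℕ) :
    ‖w ^ (i + 2) * ((hh s (i + 1) : ℂ) - hh s i)‖ ≤ 2 / ((i : ℝ) + 1) ^ 2 := by
  rw [norm_mul, norm_pow, hw, one_pow, one_mul, ← Complex.ofReal_sub, Complex.norm_real]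
  exact hh_bound s h1 h2 i

lemma RR_tendsto (w : ℂ) (hw : ‖w‖ = 1) : Tendsto (RR w) (𝓝[>] 1) (𝓝 (RR w 1)) := by
  unfold RR
  refine tendsto_tsum_of_dominated_convergence summable_bd (fun i => ?_) ?_
  · apply Tendsto.mono_left _ nhdsWithin_le_nhds
    apply Continuous.tendsto (f := fun s : ℝ => w ^ (i + 2) * ((hh s (i + 1) : ℂ) - hh s i))
    have h : ∀ j : ℕ, Continuous fun s => hh s j := fun j => by
      unfold hh
      have : ((j : ℝ) + 1) ≠ 0 := by positivity
      exact Real.continuous_const_rpow this |>.comp continuous_neg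
    have := h i
    have := h (i + 1)
    fun_prop
  · have : Set.Ioc (1 : ℝ) 2 ∈ 𝓝[>] (1 : ℝ) := Ioc_mem_nhdsGT (by norm_num)
    filter_upwards [this] with s hs i
    exact term_bd w hw s hs.1.le hs.2 i

lemma partial_tendsto (w : ℂ) (hw : ‖w‖ = 1) (hw1 : w ≠ 1) (s : ℝ) (h1 : 1 ≤ s) (h2 : s ≤ 2) :
    Tendsto (fun M => ∑ i ∈ Finset.range M, w ^ (i + 1) * (hh s i : ℂ)) atTop
      (𝓝 ((w + RR w s) / (1 - w))) := by
  have h0 : 1 - w ≠ 0 := sub_ne_zero.2 (Ne.symm hw1)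
  rw [← tendsto_add_atTop_iff_nat 1]
  have hs : Summable fun i : ℕ => w ^ (i + 2) * ((hh s (i + 1) : ℂ) - hh s i) :=
    Summable.of_norm_bounded summable_bd (term_bd w hw s h1 h2)
  have A := hs.hasSum.tendsto_sum_nat
  have B : Tendsto (fun M : ℕ => w ^ (M + 2) * (hh s M : ℂ)) atTop (𝓝 0) := by
    rw [tendsto_zero_iff_norm_tendsto_zero]
    have := (hh_tendsto s h1).norm
    simpa [hw] using this
  have C := (((tendsto_const_nhds (x := w)).sub B).add A).div_const (1 - w)
  rw [sub_zero] at C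
  refine C.congr fun M => ?_
  rw [← by_parts, mul_div_cancel_left₀ _ h0]

lemma value_one (w : ℂ) (hw : ‖w‖ = 1) (hw1 : w ≠ 1) :
    (w + RR w 1) / (1 - w) = -Complex.log (1 - w) := by
  have h := partial_tendsto w hw hw1 1 le_rfl one_le_two
  have h' : Tendsto (fun M => ∑ i ∈ Finset.range M, w ^ i / (i : ℂ)) atTop
      (𝓝 ((w + RR w 1) / (1 - w))) := by
    rw [← tendsto_add_atTop_iff_nat 1]
    refine h.congr fun M => ?_
    rw [Finset.sum_range_succ']
    simp only [hh, Real.rpow_neg_one]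
    push_cast
    simp [div_eq_mul_inv]
  have ab := Complex.tendsto_tsum_powerSeries_nhdsWithin_lt h'
  rw [tendsto_map'_iff] at ab
  have hre : w.re < 1 := by
    have h3 : w.re ≤ 1 := hw ▸ Complex.re_le_norm w
    refine lt_of_le_of_ne h3 fun h4 => hw1 ?_
    have h5 : w.re ^ 2 + w.im ^ 2 = 1 := by
      have := Complex.sq_norm w
      rw [hw, Complex.normSq_apply] at this
      nlinarith
    rw [h4] at h5
    have : w.im = 0 := by nlinarith
    exact Complex.ext (by simp [h4]) (by simp [this])
  have lim2 : Tendsto (fun x : ℝ => -Complex.log (1 - w * x)) (𝓝[<] 1) (𝓝 (-Complex.log (1 - w))) := by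
    apply Tendsto.mono_left _ nhdsWithin_le_nhds
    have : ContinuousAt (fun x : ℝ => -Complex.log (1 - w * x)) 1 := by
      apply ContinuousAt.neg
      apply ContinuousAt.clog (by fun_prop)
      left; simp; exact hre
    simpa [ContinuousAt] using this
  refine tendsto_nhds_unique ab (lim2.congr' ?_)
  have : Set.Ioo (0 : ℝ) 1 ∈ 𝓝[<] (1 : ℝ) := Ioo_mem_nhdsLT (by norm_num)
  filter_upwards [this] with x hx
  have hn : ‖w * x‖ < 1 := by
    rw [norm_mul, hw, one_mul, Complex.norm_real, Real.norm_of_nonneg hx.1.le]; exact hx.2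
  rw [← (Complex.hasSum_taylorSeries_neg_log hn).tsum_eq]
  simp only [Function.comp]
  refine tsum_congr fun m => ?_
  rw [mul_pow]; ring

lemma one_summable (w : ℂ) (hw : ‖w‖ = 1) (s : ℝ) (hs : 1 < s) :
    LSeriesSummable (fun m => w ^ m) s :=
  LSeriesSummable_of_bounded_of_one_lt_real (m := 1) (fun n _ => by simp [hw]) hs

lemma one_term (w : ℂ) (hw : ‖w‖ = 1) (hw1 : w ≠ 1) :
    Tendsto (fun s : ℝ => LSeries (fun m => w ^ m) s) (𝓝[>] 1) (𝓝 (-Complex.log (1 - w))) := by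
  rw [← value_one w hw hw1]
  have A := ((tendsto_const_nhds (x := w)).add (RR_tendsto w hw)).div_const (1 - w)
  refine A.congr' ?_
  have : Set.Ioc (1 : ℝ) 2 ∈ 𝓝[>] (1 : ℝ) := Ioc_mem_nhdsGT (by norm_num)
  filter_upwards [this] with s hs
  have B := partial_tendsto w hw hw1 s hs.1.le hs.2
  have C := (one_summable w hw s hs.1).hasSum.tendsto_sum_nat
  rw [← tendsto_add_atTop_iff_nat 1] at C
  refine tendsto_nhds_unique B (C.congr fun M => ?_)
  rw [Finset.sum_range_succ']
  simp only [LSeries.term_zero, add_zero]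
  refine Finset.sum_congr rfl fun i _ => ?_
  rw [LSeries.term_of_ne_zero (by omega), hh, div_eq_mul_inv, Real.rpow_neg (by positivity),
    Complex.ofReal_inv, Complex.ofReal_cpow (by positivity)]
  push_cast
  rfl

lemma multi_term (Z : Multiset ℂ) (hZ : ∀ z ∈ Z, ‖z‖ = 1 ∧ z ≠ -1) :
    (∀ s : ℝ, 1 < s → LSeriesSummable (fun m : ℕ => (-1) ^ (m + 1) * (Z.map (fun z => z ^ m)).sum) s) ∧
    Tendsto (fun s : ℝ => LSeries (fun m : ℕ => (-1) ^ (m + 1) * (Z.map (fun z => z ^ m)).sum) s)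
      (𝓝[>] 1) (𝓝 (Z.map (fun z => Complex.log (1 + z))).sum) := by
  induction Z using Multiset.induction_on with
  | empty =>
    have : (fun m : ℕ => (-1 : ℂ) ^ (m + 1) * ((0 : Multiset ℂ).map (fun z => z ^ m)).sum) = 0 := by
      ext m; simp
    rw [this]
    refine ⟨fun s _ => ?_, ?_⟩
    · exact LSeriesSummable_zero
    · simp
  | cons z Z ih =>
    obtain ⟨i1, i2⟩ := ih fun y hy => hZ y (Multiset.mem_cons_of_mem hy)
    obtain ⟨h1, h2⟩ := hZ z (Multiset.mem_cons_self z Z)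
    have e : (fun m : ℕ => (-1 : ℂ) ^ (m + 1) * ((z ::ₘ Z).map (fun z => z ^ m)).sum) =
        (-(fun m : ℕ => (-z) ^ m)) +
          (fun m : ℕ => (-1 : ℂ) ^ (m + 1) * (Z.map (fun z => z ^ m)).sum) := by
      ext m
      simp only [Multiset.map_cons, Multiset.sum_cons, Pi.add_apply, Pi.neg_apply]
      rw [neg_pow z]; ring
    have hw : ‖-z‖ = 1 := by rw [norm_neg, h1]
    have hw1 : -z ≠ 1 := fun h => h2 (by rw [← h, neg_neg])
    rw [e]
    refine ⟨fun s hs => ((one_summable _ hw s hs).neg).add (i1 s hs), ?_⟩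
    have T := ((one_term _ hw hw1).neg).add i2
    rw [neg_neg, sub_neg_eq_add] at T
    rw [Multiset.map_cons, Multiset.sum_cons]
    refine T.congr' ?_
    filter_upwards [self_mem_nhdsWithin] with s hs
    rw [LSeries_add (one_summable _ hw s hs).neg (i1 s hs), LSeries_neg]

lemma alt_LSeries {n : ℕ} (χ : DirichletCharacter ℂ n) (s : ℝ) (hs : 1 < s) :
    LSeries (fun m : ℕ => (-1) ^ (m + 1) * χ m) s =
      (1 - 2 * χ 2 * (2 : ℂ) ^ (-(s : ℂ))) * LSeries (χ ·) s := by
  have hre : 1 < (s : ℂ).re := by simpa using hs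
  have hS : Summable (LSeries.term (χ ·) s) := χ.LSeriesSummable_of_one_lt_re hre
  set f := LSeries.term (fun m : ℕ => χ m) s with hf
  have inj2 : Function.Injective fun k : ℕ => 2 * k := fun a b h => by simpa using h
  have inj1 : Function.Injective fun k : ℕ => 2 * k + 1 := fun a b h => by simpa using h
  have hE := hS.comp_injective inj2
  have hO := hS.comp_injective inj1
  have t1 : ∑' k, f (2 * k) + ∑' k, f (2 * k + 1) = ∑' k, f k := tsum_even_add_odd hE hO
  have e0 : ∀ k, LSeries.term (fun m : ℕ => (-1) ^ (m + 1) * χ m) s k = (-1) ^ (k + 1) * f k := by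
    intro k
    rcases eq_or_ne k 0 with rfl | hk
    · simp [hf]
    · rw [LSeries.term_of_ne_zero hk, hf, LSeries.term_of_ne_zero hk, mul_div_assoc]
  have e1 : ∀ k, LSeries.term (fun m : ℕ => (-1) ^ (m + 1) * χ m) s (2 * k) = - f (2 * k) := by
    intro k; rw [e0, pow_succ, pow_mul]; simp
  have e2 : ∀ k, LSeries.term (fun m : ℕ => (-1) ^ (m + 1) * χ m) s (2 * k + 1) = f (2 * k + 1) := by
    intro k; rw [e0, pow_succ, pow_succ, pow_mul]; simp
  have t2 : LSeries (fun m : ℕ => (-1) ^ (m + 1) * χ m) s =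
      - ∑' k, f (2 * k) + ∑' k, f (2 * k + 1) := by
    rw [LSeries, ← tsum_even_add_odd (by simp only [e1]; exact hE.neg) (by simp only [e2]; exact hO)]
    simp only [e1, e2, tsum_neg]
  have e3 : ∀ k, f (2 * k) = χ 2 * (2 : ℂ) ^ (-(s : ℂ)) * f k := by
    intro k
    rcases eq_or_ne k 0 with rfl | hk
    · simp [hf]
    · rw [hf, LSeries.term_of_ne_zero hk, LSeries.term_of_ne_zero (by omega), Nat.cast_mul (α := ℂ),
        Complex.natCast_mul_natCast_cpow, Complex.cpow_neg]
      push_cast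
      rw [map_mul]
      field_simp
  have t3 : ∑' k, f (2 * k) = χ 2 * (2 : ℂ) ^ (-(s : ℂ)) * ∑' k, f k := by
    simp only [e3, tsum_mul_left]
  rw [t2, LSeries, ← hf]
  linear_combination t1 - 2 * t3

lemma ofReal_tendsto : Tendsto (fun s : ℝ => (s : ℂ)) (𝓝[>] 1) (𝓝[≠] 1) := by
  rw [tendsto_nhdsWithin_iff]
  constructor
  · apply Tendsto.mono_left _ nhdsWithin_le_nhds
    exact Complex.continuous_ofReal.tendsto' 1 1 (by simp)
  · filter_upwards [self_mem_nhdsWithin] with s hs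
    simp only [Set.mem_compl_iff, Set.mem_singleton_iff]
    intro h
    have : s = 1 := by exact_mod_cast h
    rw [this] at hs
    exact lt_irrefl _ (Set.mem_Ioi.1 hs)

lemma alt_limit {n : ℕ} [NeZero n] (χ : DirichletCharacter ℂ n) (hodd : Odd n)
    (h2 : χ 2 = 1 → χ = 1) :
    ∃ e : ℂ, e ≠ 0 ∧ Tendsto (fun s : ℝ => LSeries (fun m : ℕ => (-1) ^ (m + 1) * χ m) s)
      (𝓝[>] 1) (𝓝 e) := by
  have key : (fun s : ℝ => LSeries (fun m : ℕ => (-1) ^ (m + 1) * χ m) s) =ᶠ[𝓝[>] 1]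
      fun s : ℝ => (1 - 2 * χ 2 * (2 : ℂ) ^ (-(s : ℂ))) * χ.LFunction s := by
    filter_upwards [self_mem_nhdsWithin] with s hs
    rw [alt_LSeries χ s hs, χ.LFunction_eq_LSeries (by simpa using hs)]
  by_cases hχ : χ = 1
  · have hu : IsUnit (2 : ZMod n) := by
      have := (ZMod.isUnit_iff_coprime 2 n).2 (Nat.coprime_two_left.2 hodd)
      exact_mod_cast this
    have hχ2 : χ 2 = 1 := by rw [hχ, MulChar.one_apply hu]
    have L : Tendsto (fun s : ℂ => (s - 1) * DirichletCharacter.LFunctionTrivChar n s) (𝓝[≠] 1) _ :=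
      DirichletCharacter.LFunctionTrivChar_residue_one
    have D : HasDerivAt (fun s : ℂ => 1 - 2 * (2 : ℂ) ^ (-s)) (Complex.log 2) 1 := by
      have := ((hasDerivAt_neg (1 : ℂ)).const_cpow (c := (2 : ℂ)) (Or.inl two_ne_zero)).const_mul (2 : ℂ)
      convert! this.const_sub 1 using 1
      rw [Complex.cpow_neg_one]; ring
    have S := hasDerivAt_iff_tendsto_slope.1 D
    refine ⟨Complex.log 2 * ∏ p ∈ n.primeFactors, (1 - (p : ℂ)⁻¹), ?_, ?_⟩
    · apply mul_ne_zero
      · have : Complex.log 2 = ((Real.log 2 : ℝ) : ℂ) := by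
          rw [Complex.ofReal_log (by norm_num)]; norm_num
        rw [this]
        exact_mod_cast (Real.log_pos one_lt_two).ne'
      · rw [Finset.prod_ne_zero_iff]
        intro p hp h0
        have hp1 := (Nat.prime_of_mem_primeFactors hp).one_lt
        rw [sub_eq_zero, eq_comm, inv_eq_one] at h0
        have : p = 1 := by exact_mod_cast h0
        omega
    · rw [tendsto_congr' key]
      refine ((S.mul L).comp ofReal_tendsto).congr' ?_
      filter_upwards [self_mem_nhdsWithin] with s hs
      have hs' : (s : ℂ) - 1 ≠ 0 := by
        rw [sub_ne_zero]; intro h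
        have : s = 1 := by exact_mod_cast h
        rw [this] at hs; exact lt_irrefl _ (Set.mem_Ioi.1 hs)
      simp only [Function.comp, slope, vsub_eq_sub, smul_eq_mul, hχ2]
      rw [hχ]
      simp only [DirichletCharacter.LFunctionTrivChar, Complex.cpow_neg_one]
      field_simp
      ring
  · refine ⟨(1 - χ 2) * χ.LFunction 1, mul_ne_zero ?_ (χ.LFunction_apply_one_ne_zero hχ), ?_⟩
    · rw [sub_ne_zero]; exact fun h => hχ (h2 h.symm)
    · rw [tendsto_congr' key]
      have c : Continuous fun s : ℂ => (1 - 2 * χ 2 * (2 : ℂ) ^ (-s)) * χ.LFunction s := by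
        have := (DirichletCharacter.differentiable_LFunction hχ).continuous
        have h3 : Continuous fun s : ℂ => (2 : ℂ) ^ (-s) :=
          continuous_neg.const_cpow (Or.inl two_ne_zero)
        fun_prop
      have T := (c.tendsto 1).comp (ofReal_tendsto.mono_right nhdsWithin_le_nhds)
      convert! T using 2
      rw [Complex.cpow_neg_one]; ring

lemma OFS_char {n : ℕ} (h : OFS n) (χ : DirichletCharacter ℂ n) (he : χ (-1) = 1) (h2 : χ 2 = 1) :
    χ = 1 := by
  ext u
  obtain ⟨_, hn, h⟩ := h
  have : NeZero n := ⟨by omega⟩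
  rw [MulChar.one_apply_coe]
  have hc : IsCoprime (((u : ZMod n).val : ℤ)) (n : ℤ) :=
    Nat.isCoprime_iff_coprime.2 (ZMod.val_coe_unit_coprime u)
  obtain ⟨j, hj⟩ := h _ hc
  rcases hj with hj | hj
  · have := (ZMod.intCast_zmod_eq_zero_iff_dvd _ n).2 hj
    push_cast at this
    rw [ZMod.natCast_zmod_val, sub_eq_zero] at this
    rw [this, map_pow, h2, one_pow]
  · have := (ZMod.intCast_zmod_eq_zero_iff_dvd _ n).2 hj
    push_cast at this
    rw [ZMod.natCast_zmod_val, add_eq_zero_iff_eq_neg] at this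
    rw [this, ← neg_one_mul, map_mul, map_pow, h2, he, one_pow, one_mul]

lemma core {n : ℕ} [NeZero n] (h : OFS n) (F : ZMod n → ℂ) (hev : ∀ x, F (-x) = F x)
    (hnon : ∀ x, ¬ IsUnit x → F x = 0)
    (hD : ∀ k : ZMod n, Tendsto (fun s : ℝ => LSeries (fun m : ℕ => (-1) ^ (m + 1) * F (m * k)) s)
      (𝓝[>] 1) (𝓝 0)) : ∀ x, F x = 0 := by
  classical
  have H0 : ∀ ψ : DirichletCharacter ℂ n, ∑ k, ψ k * F k = 0 := by
    intro ψ
    rcases ψ.even_or_odd with hψ | hψ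
    · have he : ψ⁻¹ (-1) = 1 := by
        rw [MulChar.inv_apply_eq_inv', hψ, inv_one]
      obtain ⟨e, he0, hlim⟩ := alt_limit ψ⁻¹ h.1 (OFS_char h ψ⁻¹ he)
      have id1 : ∀ m : ZMod n, ∑ k, ψ k * F (m * k) = ψ⁻¹ m * ∑ k, ψ k * F k := by
        intro m
        by_cases hm : IsUnit m
        · obtain ⟨u, rfl⟩ := hm
          rw [← Equiv.sum_comp (Units.mulLeft u) (fun k => ψ k * F k), Finset.mul_sum]
          refine Finset.sum_congr rfl fun k _ => ?_
          simp only [Units.mulLeft_apply, map_mul, MulChar.inv_apply_eq_inv']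
          have : ψ u ≠ 0 := (u.isUnit.map ψ).ne_zero
          field_simp
        · rw [MulChar.map_nonunit _ hm, zero_mul]
          refine Finset.sum_eq_zero fun k _ => ?_
          rw [hnon, mul_zero]
          exact fun hk => hm (isUnit_of_mul_isUnit_left hk)
      have T : Tendsto (fun s : ℝ => ∑ k, ψ k * LSeries (fun m : ℕ => (-1) ^ (m + 1) * F (m * k)) s)
          (𝓝[>] 1) (𝓝 0) := by
        have := tendsto_finsetSum (Finset.univ) fun k _ => (hD k).const_mul (ψ k)
        simpa using this
      have T2 := hlim.const_mul (∑ k, ψ k * F k)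
      have bd : ∀ k : ZMod n, ∀ s : ℝ, 1 < s →
          LSeriesSummable (fun m : ℕ => (-1) ^ (m + 1) * F (m * k)) s := by
        intro k s hs
        refine LSeriesSummable_of_bounded_of_one_lt_real (m := ∑ x, ‖F x‖) (fun m _ => ?_) hs
        rw [norm_mul, norm_pow, norm_neg, norm_one, one_pow, one_mul]
        exact Finset.single_le_sum (f := fun x => ‖F x‖) (fun _ _ => norm_nonneg _) (Finset.mem_univ _)
      have eq : (∑ k, ψ k * F k) * e = 0 := by
        refine tendsto_nhds_unique (T2.congr' ?_) T
        filter_upwards [self_mem_nhdsWithin] with s hs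
        rw [← LSeries_smul]
        simp_rw [← LSeries_smul]
        rw [← LSeries_sum fun k _ => (bd k s hs).smul _]
        congr 1
        ext m
        simp only [Pi.smul_apply, smul_eq_mul, Finset.sum_apply]
        have := id1 m
        calc _ = (-1) ^ (m + 1) * (ψ⁻¹ m * ∑ k, ψ k * F k) := by ring
          _ = _ := by
            rw [← this, Finset.mul_sum]
            exact Finset.sum_congr rfl fun k _ => by ring
      exact (mul_eq_zero.1 eq).resolve_right he0
    · have : ∑ k, ψ k * F k = -∑ k, ψ k * F k := by
        conv_lhs => rw [← Equiv.sum_comp (Equiv.neg (ZMod n))]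
        rw [← Finset.sum_neg_distrib]
        refine Finset.sum_congr rfl fun k _ => ?_
        rw [Equiv.neg_apply, hev, ← neg_one_mul, map_mul, hψ]; ring
      exact self_eq_neg.1 this
  intro x
  by_cases hx : IsUnit x
  · have : ∑ ψ : DirichletCharacter ℂ n, ψ x⁻¹ * ∑ k, ψ k * F k = 0 :=
      Finset.sum_eq_zero fun ψ _ => by rw [H0, mul_zero]
    simp_rw [Finset.mul_sum] at this
    rw [Finset.sum_comm] at this
    simp_rw [← mul_assoc, ← Finset.sum_mul, DirichletCharacter.sum_char_inv_mul_char_eq ℂ hx] at this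
    simp only [ite_mul, zero_mul, Finset.sum_ite_eq, Finset.mem_univ, if_true] at this
    refine (mul_eq_zero.1 this).resolve_left ?_
    exact_mod_cast (Nat.totient_pos.2 (NeZero.pos n)).ne'
  · exact hnon x hx

lemma OFS_dvd_s4 {n e : ℕ} (h : OFS n) (he : e ∣ n) : OFS e := by
  obtain ⟨ho, hn, hx⟩ := h
  have : NeZero n := ⟨by omega⟩
  have he0 : e ≠ 0 := fun h0 => by rw [h0, zero_dvd_iff] at he; omega
  refine ⟨ho.of_dvd_nat he, by omega, fun x hxe => ?_⟩
  have hu : IsUnit (x : ZMod e) := (ZMod.coe_int_isUnit_iff_isCoprime _ _).2 hxe.symm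
  obtain ⟨v, hv⟩ := ZMod.unitsMap_surjective he hu.unit
  have hc : IsCoprime (((v : ZMod n).val : ℤ)) (n : ℤ) :=
    Nat.isCoprime_iff_coprime.2 (ZMod.val_coe_unit_coprime v)
  have hvx : ((((v : ZMod n).val : ℤ)) : ZMod e) = (x : ZMod e) := by
    have := congrArg (Units.val) hv
    rw [ZMod.unitsMap_val, IsUnit.unit_spec] at this
    rw [← this]
    rw [Int.cast_natCast, ← ZMod.cast_eq_val]
  have hd : (e : ℤ) ∣ x - ((v : ZMod n).val : ℤ) := by
    rw [← ZMod.intCast_zmod_eq_zero_iff_dvd, Int.cast_sub, hvx, sub_self]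
  have hen : (e : ℤ) ∣ n := by exact_mod_cast he
  obtain ⟨j, hj | hj⟩ := hx _ hc
  · exact ⟨j, Or.inl (by simpa using dvd_add hd (hen.trans hj))⟩
  · refine ⟨j, Or.inr ?_⟩
    have := dvd_add hd (hen.trans hj)
    rwa [← add_assoc, sub_add_cancel] at this

lemma cyc (n : ℕ) : OFS n → ∀ M : ℤ → ℂ, (∀ x, M (x + n) = M x) → (∀ x, M (-x) = M x) →
    (∀ k : ℤ, Tendsto (fun s : ℝ => LSeries (fun m : ℕ => (-1) ^ (m + 1) * M (m * k)) s)
      (𝓝[>] 1) (𝓝 0)) → ∀ x, M x = 0 := by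
  induction n using Nat.strong_induction_on with
  | _ n ih =>
  intro h M hper hev hD
  have hn : 1 ≤ n := h.2.1
  have : NeZero n := ⟨by omega⟩
  have hmod : ∀ x y : ℤ, (x : ZMod n) = (y : ZMod n) → M x = M y := by
    intro x y hxy
    rw [ZMod.intCast_eq_intCast_iff_dvd_sub] at hxy
    obtain ⟨c, hc⟩ := hxy
    have P : Function.Periodic M (n : ℤ) := hper
    have := (P.int_mul c) x
    rw [← this]
    congr 1
    simp only [Int.cast_id]
    linarith
  set F : ZMod n → ℂ := fun x => M (x.val : ℤ) with hF
  have hFM : ∀ x : ℤ, F (x : ZMod n) = M x := fun x => hmod _ _ (by simp)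
  have hsurj : ∀ x : ZMod n, ((x.val : ℤ) : ZMod n) = x := fun x => by simp
  have hzero := core h F ?_ ?_ ?_
  · intro x; rw [← hFM]; exact hzero _
  · intro x
    rw [← hsurj x, ← Int.cast_neg, hFM, hFM, hev]
  · intro x hx
    rw [← hsurj x, hFM]
    rw [← hsurj x, ZMod.coe_int_isUnit_iff_isCoprime, isCoprime_comm, Int.isCoprime_iff_gcd_eq_one] at hx
    set y : ℤ := (x.val : ℤ)
    set g := Int.gcd y n with hg
    have hgn : g ∣ n := by
      have := Int.gcd_dvd_right y n
      exact_mod_cast this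
    have hgy : (g : ℤ) ∣ y := Int.gcd_dvd_left y n
    have hg0 : 0 < g := Nat.pos_of_dvd_of_pos hgn hn
    obtain ⟨e, he⟩ := hgn
    obtain ⟨z, hz⟩ := hgy
    have hlt : e < n := by
      rw [he]
      have : 0 < e := Nat.pos_of_ne_zero fun h0 => by rw [h0] at he; omega
      nlinarith [show 2 ≤ g by omega]
    have := ih e hlt (OFS_dvd_s4 h ⟨g, by rw [he, mul_comm]⟩) (fun x => M (g * x)) ?_ ?_ ?_ z
    · rw [hz]; exact this
    · intro t
      rw [mul_add, ← hper (g * t)]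
      congr 2
      rw [he]; push_cast; rfl
    · intro t
      rw [mul_neg, hev]
    · intro k
      have := hD (g * k)
      simpa only [mul_left_comm] using this
  · intro k
    refine (hD k.val).congr fun s => ?_
    congr 1
    ext m
    rw [← hFM]
    simp

lemma FS_char {G : Type*} [AddCommGroup G] (A : Multiset G) (χ : AddChar G ℂ) :
    ((FS A).map χ).sum = (A.map fun a => 1 + χ a).prod := by
  unfold FS
  induction A using Multiset.induction_on with
  | empty => simp
  | cons a A ih =>
    rw [Multiset.powerset_cons, Multiset.map_add, Multiset.map_add, Multiset.sum_add, ih,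
      Multiset.map_cons, Multiset.prod_cons, add_mul, one_mul]
    congr 1
    rw [← ih, Multiset.map_map, Multiset.map_map, Multiset.map_map, ← Multiset.sum_map_mul_left]
    congr 1
    refine Multiset.map_congr rfl fun B _ => ?_
    simp [AddChar.map_add_eq_mul]

lemma ms_ext {G : Type*} [AddCommGroup G] [Finite G] (A A' : Multiset G)
    (h : ∀ χ : AddChar G ℂ, (A.map χ).sum = (A'.map χ).sum) : A = A' := by
  classical
  have := Fintype.ofFinite G
  have key : ∀ (C : Multiset G) (x : G),
      ∑ χ : AddChar G ℂ, χ (-x) * (C.map χ).sum = (Fintype.card G : ℂ) * (C.count x) := by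
    intro C x
    induction C using Multiset.induction_on with
    | empty => simp
    | cons a C ih =>
      simp only [Multiset.map_cons, Multiset.sum_cons, mul_add, Finset.sum_add_distrib, ih]
      simp only [← AddChar.map_add_eq_mul, AddChar.sum_apply_eq_ite, Multiset.count_cons]
      have : (-x + a = 0) ↔ x = a := by rw [neg_add_eq_zero]
      by_cases hx : x = a
      · simp [this, hx]; ring
      · simp [this, hx]
  ext x
  have e := key A x
  simp only [h] at e
  rw [key A' x] at e
  have hc : (Fintype.card G : ℂ) ≠ 0 := by exact_mod_cast Fintype.card_ne_zero
  exact_mod_cast (mul_left_cancel₀ hc e).symm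

lemma root_props {n : ℕ} (hn : Odd n) {z : ℂ} (hz : z ^ n = 1) : ‖z‖ = 1 ∧ z ≠ -1 := by
  have hn0 : n ≠ 0 := by rintro rfl; simp at hn
  refine ⟨Complex.norm_eq_one_of_pow_eq_one hz hn0, ?_⟩
  rintro rfl
  rw [hn.neg_one_pow] at hz
  norm_num at hz

lemma log_prod {n : ℕ} (hn : Odd n) (Z : Multiset ℂ) (hZ : ∀ z ∈ Z, z ^ n = 1) :
    ((Z + Z.map (·⁻¹)).map fun z => Complex.log (1 + z)).sum =
      ((2 * Real.log ‖(Z.map fun z => 1 + z).prod‖ : ℝ) : ℂ) := by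
  induction Z using Multiset.induction_on with
  | empty => simp
  | cons z Z ih =>
    have ih := ih fun y hy => hZ y (Multiset.mem_cons_of_mem hy)
    obtain ⟨h1, h2⟩ := root_props hn (hZ z (Multiset.mem_cons_self z Z))
    simp only [Multiset.map_add, Multiset.map_cons, Multiset.sum_add, Multiset.sum_cons,
      Multiset.prod_cons] at ih ⊢
    have hne : 1 + z ≠ 0 := fun h => h2 (by linear_combination h)
    have hP : (Z.map fun z => 1 + z).prod ≠ 0 := by
      refine Multiset.prod_ne_zero fun hm => ?_
      obtain ⟨y, hy, hy0⟩ := Multiset.mem_map.1 hm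
      exact (root_props hn (hZ y (Multiset.mem_cons_of_mem hy))).2 (by linear_combination hy0)
    rw [norm_mul, Real.log_mul (norm_ne_zero_iff.2 hne) (norm_ne_zero_iff.2 hP)]
    have hinv : z⁻¹ = (starRingEnd ℂ) z := Complex.inv_eq_conj h1
    have hlog : Complex.log (1 + z) + Complex.log (1 + z⁻¹) = ((2 * Real.log ‖1 + z‖ : ℝ) : ℂ) := by
      have e : 1 + z⁻¹ = (starRingEnd ℂ) (1 + z) := by rw [hinv]; simp
      have harg : (1 + z).arg ≠ Real.pi := by
        intro h
        rw [Complex.arg_eq_pi_iff] at h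
        have := Complex.abs_re_le_norm z
        rw [h1, abs_le] at this
        simp at h
        linarith
      rw [e, Complex.log_conj _ harg, Complex.add_conj, Complex.log_re]
    push_cast at ih hlog ⊢
    linear_combination ih + hlog

lemma main_roots {n : ℕ} (h : OFS n) (Z Z' : Multiset ℂ) (hZ : ∀ z ∈ Z, z ^ n = 1)
    (hZ' : ∀ z ∈ Z', z ^ n = 1)
    (heq : ∀ k : ℤ, (Z.map fun z => 1 + z ^ k).prod = (Z'.map fun z => 1 + z ^ k).prod) :
    (Z + Z.map (·⁻¹)).sum = (Z' + Z'.map (·⁻¹)).sum := by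
  have base : ∀ (Y : Multiset ℂ), (∀ z ∈ Y, z ^ n = 1) → ∀ k : ℤ,
      (∀ s : ℝ, 1 < s → LSeriesSummable (fun m : ℕ => (-1) ^ (m + 1) *
        ((Y + Y.map (·⁻¹)).map (fun z => z ^ ((m : ℤ) * k))).sum) s) ∧
      Tendsto (fun s : ℝ => LSeries (fun m : ℕ => (-1) ^ (m + 1) *
        ((Y + Y.map (·⁻¹)).map (fun z => z ^ ((m : ℤ) * k))).sum) s) (𝓝[>] 1)
        (𝓝 ((2 * Real.log ‖(Y.map fun z => 1 + z ^ k).prod‖ : ℝ) : ℂ)) := by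
    intro Y hY k
    have hYk : ∀ z ∈ Y.map (· ^ k), z ^ n = 1 := by
      intro z hz
      obtain ⟨y, hy, rfl⟩ := Multiset.mem_map.1 hz
      rw [← zpow_natCast, ← zpow_mul, mul_comm, zpow_mul, zpow_natCast, hY y hy, one_zpow]
    have hYk' : ∀ z ∈ Y.map (· ^ k) + (Y.map (· ^ k)).map (·⁻¹), ‖z‖ = 1 ∧ z ≠ -1 := by
      intro z hz
      rcases Multiset.mem_add.1 hz with hz | hz
      · exact root_props h.1 (hYk z hz)
      · obtain ⟨y, hy, rfl⟩ := Multiset.mem_map.1 hz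
        refine root_props h.1 ?_
        rw [inv_pow, hYk y hy, inv_one]
    have T := multi_term _ hYk'
    rw [log_prod h.1 _ hYk] at T
    have e1 : ∀ m : ℕ, ((Y.map (· ^ k) + (Y.map (· ^ k)).map (·⁻¹)).map fun z => z ^ m).sum =
        ((Y + Y.map (·⁻¹)).map (fun z => z ^ ((m : ℤ) * k))).sum := by
      intro m
      simp only [Multiset.map_add, Multiset.map_map, Function.comp_def, mul_comm (m : ℤ) k, zpow_mul,
        zpow_natCast, inv_zpow]
    simp only [e1] at T
    rw [Multiset.map_map] at T
    exact T
  have C := cyc n h (fun x => ((Z + Z.map (·⁻¹)).map (fun z => z ^ x)).sum -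
    ((Z' + Z'.map (·⁻¹)).map (fun z => z ^ x)).sum) ?_ ?_ ?_ 1
  · simpa [sub_eq_zero] using C
  · have aux : ∀ (Y : Multiset ℂ), (∀ z ∈ Y, z ^ n = 1) → ∀ x : ℤ,
      ((Y + Y.map (·⁻¹)).map (fun z => z ^ (x + n))).sum =
      ((Y + Y.map (·⁻¹)).map (fun z => z ^ x)).sum := by
      intro Y hY x
      congr 1
      refine Multiset.map_congr rfl fun z hz => ?_
      have hz1 : z ^ n = 1 := by
        rcases Multiset.mem_add.1 hz with hz | hz
        · exact hY z hz
        · obtain ⟨y, hy, rfl⟩ := Multiset.mem_map.1 hz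
          rw [inv_pow, hY y hy, inv_one]
      have hz0 : z ≠ 0 := by
        rintro rfl
        rw [zero_pow (by have := h.2.1; omega)] at hz1
        exact zero_ne_one hz1
      rw [zpow_add₀ hz0, zpow_natCast, hz1, mul_one]
    intro x
    simp only [aux Z hZ, aux Z' hZ']
  · have aux : ∀ (Y : Multiset ℂ) (x : ℤ),
      ((Y + Y.map (·⁻¹)).map (fun z => z ^ (-x))).sum =
      ((Y + Y.map (·⁻¹)).map (fun z => z ^ x)).sum := by
      intro Y x
      simp only [Multiset.map_add, Multiset.map_map, Function.comp_def, Multiset.sum_add, zpow_neg,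
        inv_zpow, inv_inv]
      rw [add_comm]
    intro x
    simp only [aux]
  · intro k
    obtain ⟨s1, t1⟩ := base Z hZ k
    obtain ⟨s2, t2⟩ := base Z' hZ' k
    rw [heq k] at t1
    have T := t1.sub t2
    rw [sub_self] at T
    refine T.congr' ?_
    filter_upwards [self_mem_nhdsWithin] with s hs
    rw [← LSeries_sub (s1 s hs) (s2 s hs)]
    congr 1
    ext m
    simp only [Pi.sub_apply]
    ring

lemma flip_prod {G : Type*} [AddCommGroup G] (χ : AddChar G ℂ) (B : Multiset G) :
    χ B.sum * ((B.map fun x => -x).map fun a => 1 + χ a).prod = (B.map fun a => 1 + χ a).prod := by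
  induction B using Multiset.induction_on with
  | empty => simp
  | cons b B ih =>
    simp only [Multiset.map_cons, Multiset.prod_cons, Multiset.sum_cons, AddChar.map_add_eq_mul]
    rw [← ih]
    have : χ b * χ (-b) = 1 := by rw [← AddChar.map_add_eq_mul]; simp
    linear_combination (χ B.sum * ((B.map fun x => -x).map fun a => 1 + χ a).prod) * this

lemma flip_split {G : Type*} [AddCommGroup G] [DecidableEq G] (χ : AddChar G ℂ) (A B : Multiset G)
    (hB : B ≤ A) :
    χ B.sum * ((A - B + B.map fun x => -x).map fun a => 1 + χ a).prod =
      (A.map fun a => 1 + χ a).prod := by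
  conv_rhs => rw [← Multiset.sub_add_cancel hB]
  rw [Multiset.map_add, Multiset.map_add, Multiset.prod_add, Multiset.prod_add, ← flip_prod χ B]
  ring

lemma regular {G : Type*} [AddCommGroup G] [Finite G] [DecidableEq G] {n : ℕ} (h : OFS n)
    (hG : ∀ a : G, n • a = 0) (A A' : Multiset G) : FS A = FS A' ↔ Sim0 A A' := by
  constructor
  · intro hFS
    have hprod : ∀ χ : AddChar G ℂ,
        (A.map fun a => 1 + χ a).prod = (A'.map fun a => 1 + χ a).prod := fun χ => by
      rw [← FS_char, ← FS_char, hFS]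
    have hroot : ∀ (χ : AddChar G ℂ) (a : G), χ a ^ n = 1 := fun χ a => by
      rw [← AddChar.map_nsmul_eq_pow, hG, AddChar.map_zero_eq_one]
    have hsym : A + A.map (fun x => -x) = A' + A'.map (fun x => -x) := by
      refine ms_ext _ _ fun χ => ?_
      have := main_roots h (A.map χ) (A'.map χ) ?_ ?_ ?_
      · simpa only [Multiset.map_add, Multiset.map_map, Function.comp_def,
          ← AddChar.map_neg_eq_inv] using this
      · intro z hz
        obtain ⟨a, _, rfl⟩ := Multiset.mem_map.1 hz
        exact hroot χ a
      · intro z hz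
        obtain ⟨a, _, rfl⟩ := Multiset.mem_map.1 hz
        exact hroot χ a
      · intro k
        have := hprod (χ ^ k)
        simp only [Multiset.map_map, Function.comp_def]
        simpa only [AddChar.zpow_apply, AddChar.map_zsmul_eq_zpow] using this
    have hcount : ∀ x, A.count x + A.count (-x) = A'.count x + A'.count (-x) := by
      intro x
      have hn : ∀ C : Multiset G, (C.map fun x => -x).count x = C.count (-x) := fun C => by
        conv_lhs => rw [← neg_neg x]
        exact Multiset.count_map_eq_count' (fun x => -x) C neg_injective (-x)
      have := congrArg (Multiset.count x) hsym
      rwa [Multiset.count_add, Multiset.count_add, hn, hn] at this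
    have hA' : A' = (A - (A - A')) + (A - A').map (fun x => -x) := by
      ext x
      have hn : ∀ C : Multiset G, (C.map fun x => -x).count x = C.count (-x) := fun C => by
        conv_lhs => rw [← neg_neg x]
        exact Multiset.count_map_eq_count' (fun x => -x) C neg_injective (-x)
      rw [Multiset.count_add, hn, Multiset.count_sub, Multiset.count_sub, Multiset.count_sub]
      have := hcount x
      omega
    refine ⟨A - A', Multiset.sub_le_self _ _, ?_, hA'⟩
    rw [← AddChar.forall_apply_eq_zero]
    intro χ
    have e := flip_split χ A (A - A') (Multiset.sub_le_self _ _)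
    rw [← hA', hprod χ] at e
    have hP : (A'.map fun a => 1 + χ a).prod ≠ 0 := by
      refine Multiset.prod_ne_zero fun hm => ?_
      obtain ⟨y, hy, hy0⟩ := Multiset.mem_map.1 hm
      exact (root_props h.1 (hroot χ y)).2 (by linear_combination hy0)
    exact mul_right_cancel₀ hP (by rw [e, one_mul])
  · rintro ⟨B, hB, h0, rfl⟩
    refine ms_ext _ _ fun χ => ?_
    rw [FS_char, FS_char, ← flip_split χ A B hB, h0, AddChar.map_zero_eq_one, one_mul]

theorem FSRegular_of_OFS_pow (n d : ℕ) (h : OFS n) (hd : 1 ≤ d) :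
    ∀ A A' : Multiset (Fin d → ZMod n), FS A = FS A' ↔ Sim0 A A' := by
  have : NeZero n := ⟨by have := h.2.1; omega⟩
  intro A A'
  exact regular h (fun a => by ext i; simp) A A'
end

section
/- Let G be an abelian group and A, A' finite multisets with elements in G. If A ∼ A', then there exists g ∈ G such that FS(A) is equal to the multiset obtained from FS(A') by adding g to each element (with multiplicity). -/
/-- `A ∼ A'`: `A'` is obtained from `A` by flipping the signs of a sub-multiset. -/
def Sim {G : Type*} [AddCommGroup G] [DecidableEq G] (A A' : Multiset G) : Prop :=
  ∃ B ≤ A, A' = (A - B) + B.map (fun x => -x)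

theorem FS_cons_aux {G : Type*} [AddCommGroup G] (a : G) (A : Multiset G) :
    FS (a ::ₘ A) = FS A + (FS A).map (fun s => s + a) := by
  simp [FS, Multiset.powerset_cons, Multiset.map_map, Function.comp_def, add_comm]

theorem FS_flip_aux {G : Type*} [AddCommGroup G] (C B : Multiset G) :
    FS (C + B) = (FS (C + B.map (fun x => -x))).map (fun s => s + B.sum) := by
  induction B using Multiset.induction_on with
  | empty => simp
  | cons a B ih =>
    rw [Multiset.map_cons, Multiset.add_cons, Multiset.add_cons, FS_cons_aux, FS_cons_aux, ih,
      Multiset.map_add, Multiset.map_map, Multiset.map_map, Multiset.sum_cons, add_comm]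
    congr 1
    · apply Multiset.map_congr rfl
      intro x _
      simp only [Function.comp]
      abel
    · apply Multiset.map_congr rfl
      intro x _
      simp only [Function.comp]
      abel

/-- If `A ∼ A'`, then `FS A` is a translate of `FS A'`. -/
theorem FS_translate_of_sim {G : Type*} [AddCommGroup G] [DecidableEq G]
    (A A' : Multiset G) (h : Sim A A') :
    ∃ g : G, FS A = (FS A').map (fun s => s + g) := by
  obtain ⟨B, hB, rfl⟩ := h
  refine ⟨B.sum, ?_⟩
  rw [← FS_flip_aux, Multiset.sub_add_cancel hB]
end
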